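/- arXiv:2104.12185 — 3 statements merged into one kernel-verified Lean document; each statement's English description precedes it below -/
import Mathlib

section
/- Let p be a prime with p > 13 and p ∉ {19, 31}, and let F_p be the field with p elements. Let f(x) = ax² + bx + c be a quadratic polynomial in F_p[x] (so a ≠ 0) with b² - 4ac ≠ 0. Then there exists a primitive element g of F_p (i.e., a primitive root modulo p) such that f(g) is a nonzero square in F_p. -/
open Polynomial

lemma eq_zero_of_sq_eq_mul_sq {E : Type*} [Field E] {F A B : E[X]} {c : E} (hc : c ≠ 0)
    (hF : Squarefree F) (hdeg : 0 < F.natDegree) (h : A ^ 2 = C c * F * B ^ 2) :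
    A = 0 ∧ B = 0 := by
  have hF0 : F ≠ 0 := hF.ne_zero
  by_cases hB : B = 0
  · subst hB
    exact ⟨by simpa using h, rfl⟩
  exfalso
  obtain ⟨π, hπ, hπF⟩ := exists_irreducible_of_natDegree_pos hdeg
  have hp : Prime π := hπ.prime
  have hA : A ≠ 0 := by
    rintro rfl
    have : C c * F * B ^ 2 ≠ 0 := by
      refine mul_ne_zero (mul_ne_zero ?_ hF0) (pow_ne_zero _ hB)
      simpa using hc
    exact this (by rw [← h]; simp)
  have h1 : emultiplicity π F = 1 := by
    refine le_antisymm ?_ ?_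
    · rcases (squarefree_iff_emultiplicity_le_one F).1 hF π with h | h
      · exact h
      · exact absurd h hπ.not_isUnit
    · exact_mod_cast (le_emultiplicity_of_pow_dvd (k := 1) (by simpa using hπF))
  have h0 : emultiplicity π (C c) = 0 := by
    refine emultiplicity_eq_zero.2 fun hd => hπ.not_isUnit ?_
    exact isUnit_of_dvd_unit hd (isUnit_C.2 hc.isUnit)
  have key := congrArg (emultiplicity π) h
  rw [emultiplicity_mul hp, emultiplicity_mul hp, emultiplicity_pow hp, emultiplicity_pow hp, h0, h1,
    (FiniteMultiplicity.of_prime_left hp hA).emultiplicity_eq_multiplicity,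
    (FiniteMultiplicity.of_prime_left hp hB).emultiplicity_eq_multiplicity] at key
  norm_cast at key
  omega

lemma stepanov_nonvanishing {E : Type*} [Field E] {p m : ℕ} [Fact p.Prime] [CharP E p]
    {F : E[X]} (hF : Squarefree F) (hdeg : 0 < F.natDegree) (hF0 : F.coeff 0 ≠ 0)
    {h : ℕ} (hP : p ^ m = 2 * h + 1) {N : ℕ} (hN : 2 * N + F.natDegree ≤ p ^ m) (K : ℕ) :
    ∀ (A B : ℕ → E[X]), (∀ k, (A k).degree < N) → (∀ k, (B k).degree < N) →
      ∑ k ∈ Finset.range K, (A k + B k * F ^ (h + 1)) * X ^ (p ^ m * k) = 0 →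
      ∀ k < K, A k = 0 ∧ B k = 0 := by
  induction K with
  | zero => intro _ _ _ _ _ k hk; omega
  | succ K ih =>
    intro A B hA hB hsum
    set P := p ^ m with hPdef
    rw [Finset.sum_range_succ'] at hsum
    have hs : ∑ k ∈ Finset.range K, (A (k + 1) + B (k + 1) * F ^ (h + 1)) * X ^ (P * (k + 1))
        = X ^ P * ∑ k ∈ Finset.range K, (A (k + 1) + B (k + 1) * F ^ (h + 1)) * X ^ (P * k) := by
      rw [Finset.mul_sum]
      refine Finset.sum_congr rfl fun k _ => ?_
      rw [mul_add P, pow_add, mul_one]; ring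
    rw [hs] at hsum
    simp only [mul_zero, pow_zero, mul_one] at hsum
    have hd1 : X ^ P ∣ A 0 + B 0 * F ^ (h + 1) := by
      rw [← dvd_add_right (dvd_mul_right (X ^ P) _), hsum]
      exact dvd_zero _
    have hd2 : (X : E[X]) ^ P ∣ F ^ P - C (F.coeff 0 ^ P) := by
      have : F ^ P - C (F.coeff 0 ^ P) = (F - C (F.coeff 0)) ^ P := by
        rw [hPdef, sub_pow_char_pow, C_pow]
      rw [this]
      exact pow_dvd_pow_of_dvd (by rw [X_dvd_iff]; simp) _
    have hd3 : (X : E[X]) ^ P ∣ A 0 ^ 2 - C (F.coeff 0 ^ P) * F * B 0 ^ 2 := by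
      have e : A 0 ^ 2 - C (F.coeff 0 ^ P) * F * B 0 ^ 2 =
          (A 0 + B 0 * F ^ (h + 1)) * (A 0 - B 0 * F ^ (h + 1)) +
            (F ^ P - C (F.coeff 0 ^ P)) * (F * B 0 ^ 2) := by
        have : F ^ P = F ^ (2 * h + 1) := by rw [hP]
        rw [this]; ring
      rw [e]
      exact dvd_add (dvd_mul_of_dvd_left hd1 _) (dvd_mul_of_dvd_left hd2 _)
    have hc : F.coeff 0 ^ P ≠ 0 := pow_ne_zero _ hF0
    have hzero : A 0 ^ 2 - C (F.coeff 0 ^ P) * F * B 0 ^ 2 = 0 := by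
      refine eq_zero_of_dvd_of_degree_lt hd3 ?_
      rw [degree_X_pow]
      have nat_le : ∀ {q : E[X]}, q.degree < N → N = 0 ∨ q.natDegree + 1 ≤ N := by
        intro q hq
        by_cases hq0 : q = 0
        · subst hq0; simp; omega
        · right; exact (natDegree_lt_iff_degree_lt hq0).2 hq
      have hPpos : 0 < P := by omega
      rcases Nat.eq_zero_or_pos N with h0 | hNpos
      · have a0 : A 0 = 0 := by
          have := hA 0; rw [h0] at this; simpa [degree_lt_iff_coeff_zero, Polynomial.ext_iff] using this
        have b0 : B 0 = 0 := by
          have := hB 0; rw [h0] at this; simpa [degree_lt_iff_coeff_zero, Polynomial.ext_iff] using this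
        rw [a0, b0]
        simp
      have ha := (nat_le (hA 0)).resolve_left hNpos.ne'
      have hb := (nat_le (hB 0)).resolve_left hNpos.ne'
      refine lt_of_le_of_lt degree_le_natDegree ?_
      have : (A 0 ^ 2 - C (F.coeff 0 ^ P) * F * B 0 ^ 2).natDegree ≤
          max (2 * (A 0).natDegree) (F.natDegree + 2 * (B 0).natDegree) := by
        refine (natDegree_sub_le _ _).trans (max_le_max (natDegree_pow_le) ?_)
        refine natDegree_mul_le.trans (add_le_add ?_ natDegree_pow_le)
        exact (natDegree_C_mul_le _ _)
      have h2 : (A 0 ^ 2 - C (F.coeff 0 ^ P) * F * B 0 ^ 2).natDegree < P := by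
        refine this.trans_lt (max_lt ?_ ?_) <;> omega
      exact_mod_cast h2
    obtain ⟨hA0, hB0⟩ := eq_zero_of_sq_eq_mul_sq hc hF hdeg (sub_eq_zero.1 hzero)
    rw [hA0, hB0] at hsum
    have hXP : (X : E[X]) ^ P ≠ 0 := pow_ne_zero _ X_ne_zero
    have hrest := ih (fun k => A (k + 1)) (fun k => B (k + 1)) (fun k => hA _) (fun k => hB _)
      (by simpa [hXP] using hsum)
    intro k hk
    cases k with
    | zero => exact ⟨hA0, hB0⟩
    | succ k => exact hrest k (by omega)

lemma card_filter_pow_eq_le {E : Type*} [Field E] [Fintype E] [DecidableEq E] {p m : ℕ}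
    [Fact p.Prime] [CharP E p] {F : E[X]} (hF : Squarefree F) (hF0 : F.coeff 0 ≠ 0)
    {h d : ℕ} (hP : p ^ m = 2 * h + 1) (hcard : Fintype.card E = (p ^ m) ^ 2)
    (hd : F.natDegree = 2 * d) (hd0 : 0 < d) (hh : 2 * d + 2 ≤ h) {ε : E} :
    2 * (Finset.univ.filter fun z : E => F.eval z ^ ((Fintype.card E - 1) / 2) = ε).card ≤
      (p ^ m) ^ 2 + (12 * d + 8) * p ^ m := by
  set P := p ^ m with hPdef
  set N := h - d with hNdef
  set K := h + 2 * d + 2 with hKdef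
  set M := P * N + 2 * d * (h + 1) + K with hMdef
  have hN0 : 0 < N := by omega
  have hFdeg : ∀ j, (F ^ j).natDegree ≤ j * (2 * d) := fun j => by rw [← hd]; exact natDegree_pow_le
  let V := Fin K → degreeLT E N
  let Φ : V × V → E[X] := fun v =>
    ∑ k : Fin K, ((v.1 k : E[X]) ^ P + C ε * (v.2 k : E[X]) ^ P * F ^ (h + 1)) * X ^ (k : ℕ)
  have nat_lt : ∀ q : degreeLT E N, (q : E[X]).natDegree ≤ N - 1 := by
    intro q
    have hq := mem_degreeLT.1 q.2
    by_cases hq0 : (q : E[X]) = 0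
    · rw [hq0]; simp
    · have := (natDegree_lt_iff_degree_lt hq0).2 hq; omega
  have hΦ : ∀ v, Φ v ∈ degreeLT E M := by
    intro v
    refine Submodule.sum_mem _ fun k _ => ?_
    rw [mem_degreeLT]
    refine lt_of_le_of_lt degree_le_natDegree ?_
    have e1 : ((v.1 k : E[X]) ^ P).natDegree ≤ P * (N - 1) :=
      natDegree_pow_le.trans (Nat.mul_le_mul_left _ (nat_lt _))
    have e2 : (C ε * (v.2 k : E[X]) ^ P * F ^ (h + 1)).natDegree ≤
        P * (N - 1) + (h + 1) * (2 * d) := by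
      refine natDegree_mul_le.trans (add_le_add ?_ (hFdeg _))
      exact (natDegree_C_mul_le _ _).trans
        (natDegree_pow_le.trans (Nat.mul_le_mul_left _ (nat_lt _)))
    have e3 : (((v.1 k : E[X]) ^ P + C ε * (v.2 k : E[X]) ^ P * F ^ (h + 1)) *
        X ^ (k : ℕ)).natDegree ≤ P * (N - 1) + (h + 1) * (2 * d) + k := by
      refine natDegree_mul_le.trans (add_le_add ?_ (natDegree_X_pow_le _))
      refine (natDegree_add_le _ _).trans (max_le (e1.trans (Nat.le_add_right _ _)) e2)
    have hk := k.2
    have : P * (N - 1) ≤ P * N := Nat.mul_le_mul_left _ (by omega)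
    have h4 : (((v.1 k : E[X]) ^ P + C ε * (v.2 k : E[X]) ^ P * F ^ (h + 1)) *
        X ^ (k : ℕ)).natDegree < M := by
      have : (h + 1) * (2 * d) = 2 * d * (h + 1) := by ring
      omega
    exact_mod_cast h4
  have cardLT : ∀ n, Nat.card (degreeLT E n) = Fintype.card E ^ n := by
    intro n
    rw [Nat.card_congr (degreeLTEquiv E n).toEquiv]
    simp
  have hcount : M < 2 * (K * N) := by
    rw [hMdef, hP]
    obtain ⟨N', rfl⟩ : ∃ N', h = d + N' := ⟨N, by omega⟩
    have : N = N' := by omega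
    rw [this, hKdef]
    nlinarith
  have : Finite (degreeLT E M) := Finite.of_equiv _ (degreeLTEquiv E M).toEquiv.symm
  have : Finite (degreeLT E N) := Finite.of_equiv _ (degreeLTEquiv E N).toEquiv.symm
  have hq1 : 1 < Fintype.card E := Fintype.one_lt_card
  obtain ⟨v, w, hvw, hΦvw⟩ : ∃ v w : V × V, v ≠ w ∧ Φ v = Φ w := by
    by_contra! hcon
    have hinj : Function.Injective (fun v : V × V => (⟨Φ v, hΦ v⟩ : degreeLT E M)) := by
      intro v w hvw
      by_contra hne
      exact hcon v w hne (congrArg Subtype.val hvw)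
    have := Nat.card_le_card_of_injective _ hinj
    rw [Nat.card_prod, Nat.card_fun, cardLT, cardLT, Nat.card_fin, ← pow_mul, ← pow_add,
      Nat.pow_le_pow_iff_right hq1] at this
    have e : N * K = K * N := mul_comm _ _
    omega
  let A : ℕ → E[X] := fun k => if hk : k < K then (v.1 ⟨k, hk⟩ : E[X]) - w.1 ⟨k, hk⟩ else 0
  let B : ℕ → E[X] := fun k => if hk : k < K then (v.2 ⟨k, hk⟩ : E[X]) - w.2 ⟨k, hk⟩ else 0
  have hA : ∀ k, (A k).degree < N := by
    intro k
    by_cases hk : k < K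
    · simp only [A, hk, dif_pos]
      exact mem_degreeLT.1 (Submodule.sub_mem _ (v.1 ⟨k, hk⟩).2 (w.1 ⟨k, hk⟩).2)
    · simp only [A, hk, dif_neg, not_false_eq_true, degree_zero]; exact WithBot.bot_lt_coe N
  have hB : ∀ k, (B k).degree < N := by
    intro k
    by_cases hk : k < K
    · simp only [B, hk, dif_pos]
      exact mem_degreeLT.1 (Submodule.sub_mem _ (v.2 ⟨k, hk⟩).2 (w.2 ⟨k, hk⟩).2)
    · simp only [B, hk, dif_neg, not_false_eq_true, degree_zero]; exact WithBot.bot_lt_coe N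
  have hrel : ∑ k ∈ Finset.range K, (A k ^ P + C ε * B k ^ P * F ^ (h + 1)) * X ^ k = 0 := by
    rw [Finset.sum_range]
    rw [← sub_eq_zero] at hΦvw
    rw [← hΦvw]
    simp only [Φ]
    rw [← Finset.sum_sub_distrib]
    refine Finset.sum_congr rfl fun k _ => ?_
    simp only [A, B, k.2, dif_pos, hPdef, sub_pow_char_pow]
    ring
  set g : E[X] := ∑ k ∈ Finset.range K, (A k + B k * F ^ (h + 1)) * X ^ (P * k) with hg
  have hg0 : g ≠ 0 := by
    intro hg0
    have hz := stepanov_nonvanishing (p := p) (m := m) hF (by omega) hF0 hP (N := N) (by omega) K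
      A B hA hB hg0
    apply hvw
    have h1 : v.1 = w.1 := by
      funext k
      have := (hz k k.2).1
      simp only [A, k.2, dif_pos] at this
      exact Subtype.ext (sub_eq_zero.1 this)
    have h2 : v.2 = w.2 := by
      funext k
      have := (hz k k.2).2
      simp only [B, k.2, dif_pos] at this
      exact Subtype.ext (sub_eq_zero.1 this)
    exact Prod.ext h1 h2
  have hcardE : (Fintype.card E - 1) / 2 + (h + 1) = P * (h + 1) := by
    rw [hcard, hP]
    have : (2 * h + 1) ^ 2 - 1 = 2 * (2 * h * h + 2 * h) := by
      rw [Nat.sub_eq_iff_eq_add (Nat.one_le_pow _ _ (by omega))]; ring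
    rw [this, Nat.mul_div_cancel_left _ (by norm_num)]; ring
  have hroot : ∀ z : E, F.eval z ^ ((Fintype.card E - 1) / 2) = ε → g.eval z = 0 := by
    intro z hz
    have hzP : ∀ k, (z ^ (P * k)) ^ P = z ^ k := by
      intro k
      have : P * k * P = Fintype.card E * k := by rw [hcard]; ring
      rw [← pow_mul, this, pow_mul, FiniteField.pow_card]
    have : g.eval z ^ P = 0 := by
      have e := congrArg (Polynomial.eval z) hrel
      rw [eval_finsetSum, eval_zero] at e
      rw [← e, hg, eval_finsetSum, hPdef, sum_pow_char_pow]
      refine Finset.sum_congr rfl fun k _ => ?_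
      simp only [eval_mul, eval_add, eval_pow, eval_X, eval_C]
      rw [mul_pow, add_pow_char_pow, ← hPdef, hzP, mul_pow, ← pow_mul, mul_comm (h + 1) P, ← hcardE,
        pow_add, hz]
      ring
    exact pow_eq_zero_iff (by omega) |>.1 this
  have hle : (Finset.univ.filter fun z : E => F.eval z ^ ((Fintype.card E - 1) / 2) = ε).card ≤
      g.natDegree := by
    refine card_le_degree_of_subset_roots (p := g) fun z hz => ?_
    simp only [Finset.mem_val, Finset.mem_filter, Finset.mem_univ, true_and] at hz
    exact (mem_roots hg0).2 (hroot z hz)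
  have nat_le : ∀ {q : E[X]}, q.degree < N → q.natDegree ≤ N := fun hq =>
    natDegree_le_of_degree_le hq.le
  have hgdeg : g.natDegree ≤ N + (h + 1) * (2 * d) + P * (K - 1) := by
    refine natDegree_sum_le_of_forall_le _ _ fun k hk => ?_
    have hk' : k ≤ K - 1 := by have := Finset.mem_range.1 hk; omega
    refine natDegree_mul_le.trans (add_le_add ?_ ((natDegree_X_pow_le _).trans
      (Nat.mul_le_mul_left _ hk')))
    refine (natDegree_add_le _ _).trans (max_le ((nat_le (hA k)).trans (Nat.le_add_right _ _)) ?_)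
    exact natDegree_mul_le.trans (add_le_add (nat_le (hB k)) (hFdeg _))
  refine (Nat.mul_le_mul_left 2 (hle.trans hgdeg)).trans ?_
  have hK1 : K - 1 = h + 2 * d + 1 := by omega
  rw [hK1, hP]
  have : N ≤ h := by omega
  nlinarith

lemma abs_sum_quadraticChar_eval_le {E : Type*} [Field E] [Fintype E] [DecidableEq E] {p m : ℕ}
    [Fact p.Prime] [CharP E p] {F : E[X]} (hF : Squarefree F) (hF0 : F.coeff 0 ≠ 0)
    {h d : ℕ} (hP : p ^ m = 2 * h + 1) (hcard : Fintype.card E = (p ^ m) ^ 2)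
    (hd : F.natDegree = 2 * d) (hd0 : 0 < d) (hh : 2 * d + 2 ≤ h) :
    |∑ z : E, quadraticChar E (F.eval z)| ≤ (14 * d + 8) * (p ^ m : ℕ) := by
  have hchar : ringChar E ≠ 2 := by
    rw [ringChar.eq E p]
    rintro rfl
    rcases Nat.eq_zero_or_pos m with rfl | hm
    · simp at hP; omega
    · have := dvd_pow_self 2 hm.ne'; omega
  have hodd : Fintype.card E / 2 = (Fintype.card E - 1) / 2 := by
    have : Fintype.card E % 2 = 1 := FiniteField.odd_card_of_char_ne_two hchar
    omega
  set S := ∑ z : E, quadraticChar E (F.eval z) with hS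
  have count : ∀ ε : ℤ, (ε = 1 ∨ ε = -1) →
      2 * ((Finset.univ.filter fun z : E => quadraticChar E (F.eval z) = ε).card : ℤ) ≤
        (p ^ m : ℕ) ^ 2 + (12 * d + 8) * (p ^ m : ℕ) := by
    intro ε hε
    have := card_filter_pow_eq_le hF hF0 hP hcard hd hd0 hh (ε := (ε : E))
    refine le_trans ?_ (Int.ofNat_le.2 this |>.trans (by push_cast; exact le_rfl))
    push_cast
    gcongr with z _
    intro hz
    rw [← hodd, ← quadraticChar_eq_pow_of_char_ne_two' hchar, hz]
  have hzero : ((Finset.univ.filter fun z : E => quadraticChar E (F.eval z) = 0).card : ℤ) ≤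
      2 * d := by
    have e : (2 * d : ℤ) = (F.natDegree : ℕ) := by rw [hd]; push_cast; rfl
    rw [e, Nat.cast_le]
    refine card_le_degree_of_subset_roots (p := F) fun z hz => ?_
    simp only [Finset.mem_val, Finset.mem_filter, Finset.mem_univ, true_and,
      quadraticChar_eq_zero_iff] at hz
    exact (mem_roots hF.ne_zero).2 hz
  have htri : ∀ z : E, quadraticChar E (F.eval z) = 0 ∨ quadraticChar E (F.eval z) = 1 ∨
      quadraticChar E (F.eval z) = -1 := by
    intro z
    by_cases hz : F.eval z = 0
    · left; simp [hz]
    · right; exact quadraticChar_dichotomy hz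
  have total : ((Finset.univ.filter fun z : E => quadraticChar E (F.eval z) = 0).card : ℤ) +
      (Finset.univ.filter fun z : E => quadraticChar E (F.eval z) = 1).card +
      (Finset.univ.filter fun z : E => quadraticChar E (F.eval z) = -1).card =
        (p ^ m : ℕ) ^ 2 := by
    have e : ((Fintype.card E : ℕ) : ℤ) = (p ^ m : ℕ) ^ 2 := by rw [hcard]; push_cast; rfl
    rw [← e, ← Finset.card_univ, Finset.card_eq_sum_ones (Finset.univ : Finset E)]
    simp only [Finset.card_filter, Nat.cast_sum]
    rw [← Finset.sum_add_distrib, ← Finset.sum_add_distrib]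
    refine Finset.sum_congr rfl fun z _ => ?_
    rcases htri z with h | h | h <;> simp [h]
  have hSeq : S = (Finset.univ.filter fun z : E => quadraticChar E (F.eval z) = 1).card -
      (Finset.univ.filter fun z : E => quadraticChar E (F.eval z) = -1).card := by
    simp only [hS, Finset.card_filter, Nat.cast_sum, ← Finset.sum_sub_distrib]
    refine Finset.sum_congr rfl fun z _ => ?_
    rcases htri z with h | h | h <;> simp [h]
  have h1 := count 1 (Or.inl rfl)
  have h2 := count (-1) (Or.inr rfl)
  have hP1 : (1 : ℤ) ≤ (p ^ m : ℕ) := by rw [hP]; push_cast; omega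
  rw [abs_le]
  constructor <;> nlinarith

lemma norm_mulChar_le_one {F : Type*} [Field F] [Finite F] (χ : MulChar F ℂ) (x : F) :
    ‖χ x‖ ≤ 1 := by
  by_cases hx : x = 0
  · rw [hx, MulChar.map_zero, norm_zero]; exact zero_le_one
  · have := Fintype.ofFinite F
    have : χ x ^ (Fintype.card F - 1) = 1 := by
      rw [← map_pow, FiniteField.pow_card_sub_one_eq_one x hx, map_one]
    refine (Complex.norm_eq_one_of_pow_eq_one this ?_).le
    have := Fintype.one_lt_card (α := F)
    omega

lemma squarefree_quadratic_comp {E : Type*} [Field E] {p : ℕ} [hp : Fact p.Prime] [CharP E p]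
    {b c t : E} (hc : c ≠ 0) (hD : b ^ 2 - 4 * c ≠ 0) :
    Squarefree ((C t * X ^ (p - 1)) ^ 2 + C b * (C t * X ^ (p - 1)) + C c) := by
  refine Separable.squarefree ?_
  set Y : E[X] := C t * X ^ (p - 1) with hY
  have hXY : X * derivative Y = -Y := by
    have hcast : ((p - 1 : ℕ) : E[X]) = -1 := by
      rw [Nat.cast_sub hp.out.one_lt.le, CharP.cast_eq_zero, Nat.cast_one, zero_sub]
    have h1 : p - 1 = (p - 1 - 1) + 1 := by have := hp.out.two_le; omega
    rw [hY, derivative_C_mul, derivative_X_pow, map_natCast, hcast]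
    conv_rhs => rw [h1, pow_succ]
    ring
  have hder : X * derivative (Y ^ 2 + C b * Y + C c) = -(2 * Y ^ 2 + C b * Y) := by
    simp only [derivative_add, derivative_mul, derivative_C, pow_two]
    linear_combination (2 * Y + C b) * hXY
  refine ⟨C ((c * (b ^ 2 - 4 * c))⁻¹) * (C (b ^ 2 - 4 * c) + 4 * Y * (Y + C b)),
    C ((c * (b ^ 2 - 4 * c))⁻¹) * (Y + C b) * (2 * Y + C b) * X, ?_⟩
  have hone : C ((c * (b ^ 2 - 4 * c))⁻¹) * (C c * (C b ^ 2 - 4 * C c)) = (1 : E[X]) := by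
    have : (C c * (C b ^ 2 - 4 * C c) : E[X]) = C (c * (b ^ 2 - 4 * c)) := by
      simp only [C_sub, C_pow, C_mul, map_ofNat]
    rw [this, ← C_mul, inv_mul_cancel₀ (mul_ne_zero hc hD), C_1]
  rw [← hone, mul_assoc _ X, hder]
  simp only [C_sub, C_pow, C_mul, map_ofNat]
  ring

lemma norm_sum_norm_mul_quadraticChar_le {p m : ℕ} [hp : Fact p.Prime]
    {E : Type*} [Field E] [Fintype E] [DecidableEq E] [Algebra (ZMod p) E]
    (hcard : Fintype.card E = (p ^ m) ^ 2) (hp2 : p ≠ 2) (hpm : 4 * p + 1 ≤ p ^ m)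
    {b c : ZMod p} (hc : c ≠ 0) (hD : b ^ 2 - 4 * c ≠ 0) (χ : MulChar (ZMod p) ℂ) :
    ‖∑ x : E, χ (Algebra.norm (ZMod p) x) *
      (quadraticChar E (x ^ 2 + algebraMap _ E b * x + algebraMap _ E c) : ℂ)‖ ≤
      (14 * p + 9) * (p : ℝ) ^ m := by
  have : CharP E p := charP_of_injective_algebraMap (algebraMap (ZMod p) E).injective p
  set b' := algebraMap (ZMod p) E b with hb'
  set c' := algebraMap (ZMod p) E c with hc'
  have hc'0 : c' ≠ 0 := by simpa [hc'] using hc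
  have hD' : b' ^ 2 - 4 * c' ≠ 0 := by
    have : b' ^ 2 - 4 * c' = algebraMap (ZMod p) E (b ^ 2 - 4 * c) := by
      simp only [map_sub, map_pow, map_mul, map_ofNat, hb', hc']
    rw [this]; exact (_root_.map_ne_zero _).2 hD
  obtain ⟨h, hh⟩ : Odd (p ^ m) := (hp.out.odd_of_ne_two hp2).pow
  have hp3 : 3 ≤ p := by have := hp.out.two_le; omega
  let f : E → E := fun x => x ^ 2 + b' * x + c'
  have inner : ∀ t : Eˣ, ‖∑ z : Eˣ, (quadraticChar E (f (t * z ^ (p - 1))) : ℂ)‖ ≤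
      (14 * p + 9) * (p : ℝ) ^ m := by
    intro t
    set F : E[X] := (C (t : E) * X ^ (p - 1)) ^ 2 + C b' * (C (t : E) * X ^ (p - 1)) + C c' with hF
    have hsq : Squarefree F := squarefree_quadratic_comp hc'0 hD'
    have hp1 : p - 1 ≠ 0 := by omega
    have hdeg : F.natDegree = 2 * (p - 1) := by
      have h1 : (C (t : E) * X ^ (p - 1)).natDegree = p - 1 := by
        rw [natDegree_C_mul_X_pow _ _ t.ne_zero]
      have h2 : ((C (t : E) * X ^ (p - 1)) ^ 2).natDegree = 2 * (p - 1) := by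
        rw [natDegree_pow, h1]
      rw [hF, natDegree_add_C, natDegree_add_eq_left_of_natDegree_lt, h2]
      rw [h2]
      refine (natDegree_C_mul_le _ _).trans_lt ?_
      rw [h1]; omega
    have hF0 : F.coeff 0 ≠ 0 := by
      rw [coeff_zero_eq_eval_zero]
      simpa [hF, hp1] using hc'0
    have key := abs_sum_quadraticChar_eval_le hsq hF0 hh hcard hdeg (by omega) (by omega)
    have heval : ∀ z : E, F.eval z = f (t * z ^ (p - 1)) := by
      intro z; simp [hF, f]
    simp only [heval] at key
    have hsplit : ∑ z : E, (quadraticChar E (f (t * z ^ (p - 1))) : ℂ) =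
        (quadraticChar E (f 0) : ℂ) + ∑ z : Eˣ, (quadraticChar E (f (t * z ^ (p - 1))) : ℂ) := by
      rw [Fintype.sum_eq_add_sum_compl 0, ← Finset.sum_subtype _ (p := fun z : E => z ≠ 0)
        (by simp) (fun z => (quadraticChar E (f (t * z ^ (p - 1))) : ℂ)) |>.symm]
      congr 1
      · simp [hp1]
      · exact (Fintype.sum_equiv unitsEquivNeZero _ _ (fun z => by simp)).symm
    have h0 : ‖(quadraticChar E (f 0) : ℂ)‖ ≤ 1 := by
      by_cases h : f 0 = 0
      · simp [h]
      · rcases quadraticChar_dichotomy h with h | h <;> simp [h]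
    have hn : ‖∑ z : E, (quadraticChar E (f (t * z ^ (p - 1))) : ℂ)‖ ≤
        (14 * (p - 1 : ℕ) + 8) * (p : ℝ) ^ m := by
      rw [← Int.cast_sum, Complex.norm_intCast]
      exact_mod_cast key
    have e : ∑ z : Eˣ, (quadraticChar E (f (t * z ^ (p - 1))) : ℂ) =
      ∑ z : E, (quadraticChar E (f (t * z ^ (p - 1))) : ℂ) - (quadraticChar E (f 0) : ℂ) := by
      rw [hsplit]; ring
    rw [e]
    refine (norm_sub_le _ _).trans ((add_le_add hn h0).trans ?_)
    have hP1 : (1 : ℝ) ≤ (p : ℝ) ^ m := one_le_pow₀ (by exact_mod_cast hp.out.one_lt.le)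
    rw [Nat.cast_sub hp.out.one_lt.le]
    push_cast
    nlinarith
  set S := ∑ x : E, χ (Algebra.norm (ZMod p) x) * (quadraticChar E (f x) : ℂ) with hS
  have hSu : S = ∑ u : Eˣ, χ (Algebra.norm (ZMod p) (u : E)) * (quadraticChar E (f u) : ℂ) := by
    rw [hS, Fintype.sum_eq_add_sum_compl 0, ← Finset.sum_subtype _ (p := fun z : E => z ≠ 0)
      (by simp) (fun z => χ (Algebra.norm (ZMod p) z) * (quadraticChar E (f z) : ℂ)) |>.symm]
    rw [Algebra.norm_zero, MulChar.map_zero, zero_mul, zero_add]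
    exact (Fintype.sum_equiv unitsEquivNeZero _ _ (fun z => by simp)).symm
  have hshift : ∀ z : Eˣ, S = ∑ t : Eˣ, χ (Algebra.norm (ZMod p) (t : E)) *
      (quadraticChar E (f (t * z ^ (p - 1))) : ℂ) := by
    intro z
    rw [hSu, ← Equiv.sum_comp (Equiv.mulRight (z ^ (p - 1)))]
    refine Finset.sum_congr rfl fun t _ => ?_
    have hz : Algebra.norm (ZMod p) (z : E) ^ (p - 1) = 1 :=
      ZMod.pow_card_sub_one_eq_one (by simp)
    simp [hz]
  have hN : (0 : ℝ) < Fintype.card Eˣ := by exact_mod_cast Fintype.card_pos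
  have hmul : (Fintype.card Eˣ : ℂ) * S = ∑ t : Eˣ, χ (Algebra.norm (ZMod p) (t : E)) *
      ∑ z : Eˣ, (quadraticChar E (f (t * z ^ (p - 1))) : ℂ) := by
    simp only [Finset.mul_sum]
    rw [Finset.sum_comm, ← Finset.sum_congr rfl (fun z _ => hshift z)]
    simp
  have hnorm : (Fintype.card Eˣ : ℝ) * ‖S‖ ≤ Fintype.card Eˣ * ((14 * p + 9) * (p : ℝ) ^ m) := by
    have : (Fintype.card Eˣ : ℝ) * ‖S‖ = ‖(Fintype.card Eˣ : ℂ) * S‖ := by simp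
    rw [this, hmul]
    refine (norm_sum_le _ _).trans ?_
    refine (Finset.sum_le_card_nsmul _ _ ((14 * p + 9) * (p : ℝ) ^ m) fun t _ => ?_).trans ?_
    · rw [norm_mul]
      refine (mul_le_mul (norm_mulChar_le_one χ _) (inner t) (norm_nonneg _) zero_le_one).trans ?_
      rw [one_mul]
    · simp
  exact le_of_mul_le_mul_left hnorm hN

open UniqueFactorizationMonoid in
lemma Polynomial.pow_dvd_iff_le_count {F : Type*} [Field F] [DecidableEq F] {P h : F[X]}
    (hP : Irreducible P) (hm : P.Monic) (hh : h ≠ 0) (j : ℕ) :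
    P ^ j ∣ h ↔ j ≤ (normalizedFactors h).count P := by
  rw [pow_dvd_iff_le_emultiplicity, emultiplicity_eq_count_normalizedFactors hP hh,
    hm.normalize_eq_self, Nat.cast_le]

lemma Polynomial.finite_monic_natDegree_eq (F : Type*) [Field F] [Finite F] (n : ℕ) :
    {h : F[X] | h.Monic ∧ h.natDegree = n}.Finite := by
  have : Finite (degreeLT F (n + 1)) := Finite.of_equiv _ (degreeLTEquiv F (n + 1)).toEquiv.symm
  refine Set.Finite.subset (Set.toFinite (degreeLT F (n + 1) : Set F[X])) ?_
  rintro h ⟨-, hn⟩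
  exact mem_degreeLT.2 (lt_of_le_of_lt degree_le_natDegree (by rw [hn]; exact_mod_cast n.lt_succ_self))

/-- The monic polynomials of degree `n` over a finite field. -/
noncomputable def monicOfDegree (F : Type*) [Field F] [Finite F] (n : ℕ) : Finset F[X] :=
  (Polynomial.finite_monic_natDegree_eq F n).toFinset

lemma mem_monicOfDegree {F : Type*} [Field F] [Finite F] {n : ℕ} {h : F[X]} :
    h ∈ monicOfDegree F n ↔ h.Monic ∧ h.natDegree = n := by
  simp [monicOfDegree]

open scoped Classical in
/-- The monic irreducible polynomials whose degree divides `k`. -/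
noncomputable def primesOfDegreeDvd (F : Type*) [Field F] [Finite F] (k : ℕ) : Finset F[X] :=
  (k.divisors.biUnion (monicOfDegree F)).filter Irreducible

lemma mem_primesOfDegreeDvd {F : Type*} [Field F] [Finite F] {k : ℕ} (hk : k ≠ 0) {P : F[X]} :
    P ∈ primesOfDegreeDvd F k ↔ P.Monic ∧ Irreducible P ∧ P.natDegree ∣ k := by
  simp [primesOfDegreeDvd, mem_monicOfDegree, hk]
  tauto

open scoped Classical in
open UniqueFactorizationMonoid in
lemma sum_natDegree_primesOfDegreeDvd {F : Type*} [Field F] [Finite F] {n : ℕ} {h : F[X]}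
    (hh : h ∈ monicOfDegree F n) :
    ∑ k ∈ Finset.Icc 1 n, ∑ P ∈ primesOfDegreeDvd F k,
      (if P ^ (k / P.natDegree) ∣ h then P.natDegree else 0) = n := by
  obtain ⟨hmon, hdeg⟩ := mem_monicOfDegree.1 hh
  have hh0 : h ≠ 0 := hmon.ne_zero
  have hfac : ∀ P ∈ normalizedFactors h, P.Monic ∧ Irreducible P := by
    intro P hP
    have hi := irreducible_of_normalized_factor P hP
    refine ⟨?_, hi⟩
    rw [← normalize_normalized_factor P hP]
    exact monic_normalize hi.ne_zero
  have hprod : (normalizedFactors h).prod = h :=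
    eq_of_monic_of_associated (by
      simpa using monic_multiset_prod_of_monic (normalizedFactors h) id fun P hP => (hfac P hP).1)
      hmon (prod_normalizedFactors hh0)
  have hn : n = ∑ P ∈ (normalizedFactors h).toFinset, (normalizedFactors h).count P * P.natDegree := by
    rw [← hdeg]
    conv_lhs => rw [← hprod, natDegree_multiset_prod_of_monic _ fun P hP => (hfac P hP).1]
    rw [Finset.sum_multiset_map_count]
    simp
  have hn' : n = ∑ P ∈ (normalizedFactors h).toFinset,
      ∑ j ∈ Finset.Icc 1 ((normalizedFactors h).count P), P.natDegree := by
    rw [hn]; simp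
  have hle : ∀ P ∈ normalizedFactors h, (normalizedFactors h).count P * P.natDegree ≤ n := by
    intro P hP
    rw [hn]
    exact Finset.single_le_sum (f := fun P => (normalizedFactors h).count P * P.natDegree)
      (fun _ _ => Nat.zero_le _) (Multiset.mem_toFinset.2 hP)
  conv_rhs => rw [hn']
  simp only [← Finset.sum_filter]
  rw [Finset.sum_sigma', Finset.sum_sigma']
  refine Finset.sum_bij' (fun x _ => ⟨x.2, x.1 / x.2.natDegree⟩)
    (fun y _ => ⟨y.2 * y.1.natDegree, y.1⟩) ?_ ?_ ?_ ?_ ?_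
  · rintro ⟨k, P⟩ hx
    simp only [Finset.mem_sigma, Finset.mem_Icc, Finset.mem_filter] at hx ⊢
    obtain ⟨⟨h1, h2⟩, hP, hd⟩ := hx
    obtain ⟨hPm, hPi, hPd⟩ := (mem_primesOfDegreeDvd (by omega)).1 hP
    have hpos : 0 < P.natDegree := hPi.natDegree_pos
    have h3 : 1 ≤ k / P.natDegree := Nat.div_pos (Nat.le_of_dvd h1 hPd) hpos
    have h4 := (Polynomial.pow_dvd_iff_le_count hPi hPm hh0 _).1 hd
    exact ⟨Multiset.mem_toFinset.2 (Multiset.count_pos.1 (by omega)), h3, h4⟩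
  · rintro ⟨P, j⟩ hy
    simp only [Finset.mem_sigma, Finset.mem_Icc, Finset.mem_filter, Multiset.mem_toFinset] at hy ⊢
    obtain ⟨hP, h1, h2⟩ := hy
    obtain ⟨hPm, hPi⟩ := hfac P hP
    have hpos : 0 < P.natDegree := hPi.natDegree_pos
    have hpos' : 1 ≤ j * P.natDegree := Nat.mul_pos h1 hpos
    refine ⟨⟨hpos', (Nat.mul_le_mul_right _ h2).trans (hle P hP)⟩,
      (mem_primesOfDegreeDvd (by omega)).2 ⟨hPm, hPi, dvd_mul_left _ _⟩, ?_⟩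
    rw [Nat.mul_div_cancel _ hpos]
    exact (Polynomial.pow_dvd_iff_le_count hPi hPm hh0 _).2 h2
  · rintro ⟨k, P⟩ hx
    simp only [Finset.mem_sigma, Finset.mem_Icc, Finset.mem_filter] at hx ⊢
    obtain ⟨⟨h1, h2⟩, hP, hd⟩ := hx
    obtain ⟨hPm, hPi, hPd⟩ := (mem_primesOfDegreeDvd (by omega)).1 hP
    rw [Nat.div_mul_cancel hPd]
  · rintro ⟨P, j⟩ hy
    simp only [Finset.mem_sigma, Finset.mem_Icc, Multiset.mem_toFinset] at hy ⊢
    rw [Nat.mul_div_cancel _ (hfac P hy.1).2.natDegree_pos]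
  · rintro ⟨k, P⟩ _
    rfl

open scoped Classical in
/-- The logarithmic derivative of the Euler product, compared coefficientwise. -/
lemma mul_sum_monicOfDegree {F : Type*} [Field F] [Finite F] (ψ : F[X] →* ℂ) (n : ℕ) :
    (n : ℂ) * ∑ h ∈ monicOfDegree F n, ψ h =
      ∑ k ∈ Finset.Icc 1 n, (∑ P ∈ primesOfDegreeDvd F k, (P.natDegree : ℂ) *
        ψ P ^ (k / P.natDegree)) * ∑ h ∈ monicOfDegree F (n - k), ψ h := by
  have step : ∀ k ∈ Finset.Icc 1 n, ∀ P ∈ primesOfDegreeDvd F k,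
      ∑ h ∈ monicOfDegree F n, (if P ^ (k / P.natDegree) ∣ h then ψ h else 0) =
        ψ P ^ (k / P.natDegree) * ∑ h ∈ monicOfDegree F (n - k), ψ h := by
    intro k hk P hP
    rw [Finset.mem_Icc] at hk
    obtain ⟨hPm, hPi, hPd⟩ := (mem_primesOfDegreeDvd (by omega)).1 hP
    have hQm : (P ^ (k / P.natDegree)).Monic := hPm.pow _
    have hQd : (P ^ (k / P.natDegree)).natDegree = k := by
      rw [natDegree_pow, Nat.div_mul_cancel hPd]
    rw [← Finset.sum_filter, Finset.mul_sum]
    symm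
    refine Finset.sum_bij (fun h _ => P ^ (k / P.natDegree) * h) ?_ ?_ ?_ ?_
    · intro h hh
      obtain ⟨h1, h2⟩ := mem_monicOfDegree.1 hh
      refine Finset.mem_filter.2 ⟨mem_monicOfDegree.2 ⟨hQm.mul h1, ?_⟩, dvd_mul_right _ _⟩
      rw [hQm.natDegree_mul h1, hQd, h2]; omega
    · intro a _ b _ hab
      exact mul_left_cancel₀ hQm.ne_zero hab
    · intro h hh
      obtain ⟨h1, q, rfl⟩ := Finset.mem_filter.1 hh
      obtain ⟨h2, h3⟩ := mem_monicOfDegree.1 h1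
      have hq : q.Monic := hQm.of_mul_monic_left h2
      refine ⟨q, mem_monicOfDegree.2 ⟨hq, ?_⟩, rfl⟩
      rw [hQm.natDegree_mul hq, hQd] at h3; omega
    · intro h _
      rw [map_mul, map_pow]
  have lhs : (n : ℂ) * ∑ h ∈ monicOfDegree F n, ψ h = ∑ h ∈ monicOfDegree F n,
      ∑ k ∈ Finset.Icc 1 n, ∑ P ∈ primesOfDegreeDvd F k,
        (P.natDegree : ℂ) * (if P ^ (k / P.natDegree) ∣ h then ψ h else 0) := by
    rw [Finset.mul_sum]
    refine Finset.sum_congr rfl fun h hh => ?_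
    conv_lhs => rw [← sum_natDegree_primesOfDegreeDvd hh]
    push_cast
    simp only [Finset.sum_mul]
    refine Finset.sum_congr rfl fun k _ => Finset.sum_congr rfl fun P _ => ?_
    split_ifs <;> simp
  rw [lhs, Finset.sum_comm]
  refine Finset.sum_congr rfl fun k hk => ?_
  rw [Finset.sum_comm, Finset.sum_mul]
  refine Finset.sum_congr rfl fun P hP => ?_
  rw [← Finset.mul_sum, step k hk P hP, mul_assoc]

open IntermediateField in
lemma algebraMap_norm_aeval {K E : Type*} [Field K] [Finite K] [Field E] [Finite E] [Algebra K E]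
    (x : E) (g : K[X]) :
    algebraMap K (AlgebraicClosure K) (Algebra.norm K (aeval x g)) =
      (((minpoly K x).aroots (AlgebraicClosure K)).map fun r => aeval r g).prod ^
        Module.finrank K⟮x⟯ E := by
  have hx : IsIntegral K x := IsIntegral.of_finite K x
  have h1 : aeval x g = algebraMap K⟮x⟯ E (aeval (AdjoinSimple.gen K x) g) := by
    rw [← aeval_algebraMap_apply, AdjoinSimple.algebraMap_gen]
  have hsep : (minpoly K x).Separable := Algebra.IsSeparable.isSeparable K x
  rw [h1, ← Algebra.norm_norm (S := K⟮x⟯), Algebra.norm_algebraMap, map_pow, map_pow]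
  congr 1
  let pb := adjoin.powerBasis hx
  have hpb : minpoly K pb.gen = minpoly K x := by
    rw [adjoin.powerBasis_gen hx, minpoly_gen]
  rw [Algebra.norm_eq_prod_embeddings K (AlgebraicClosure K)]
  have hnd : ((minpoly K x).aroots (AlgebraicClosure K)).Nodup := nodup_roots hsep.map
  classical
  rw [← Multiset.dedup_eq_self.2 hnd, ← Multiset.toFinset_val]
  change _ = ∏ r ∈ ((minpoly K x).aroots (AlgebraicClosure K)).toFinset, aeval r g
  refine Finset.prod_bij (fun σ _ => σ pb.gen) ?_ ?_ ?_ ?_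
  · intro σ _
    rw [Multiset.mem_toFinset, ← hpb]
    exact (pb.liftEquiv' σ).2
  · intro σ _ τ _ h
    exact pb.liftEquiv'.injective (Subtype.ext h)
  · intro r hr
    rw [Multiset.mem_toFinset, ← hpb] at hr
    refine ⟨pb.liftEquiv'.symm ⟨r, hr⟩, Finset.mem_univ _, ?_⟩
    exact congrArg Subtype.val (pb.liftEquiv'.apply_symm_apply ⟨r, hr⟩)
  · intro σ _
    rw [← aeval_algHom_apply, adjoin.powerBasis_gen hx]

/-- The resultant of `h` and the monic quadratic polynomial `X ^ 2 + b X + c`. -/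
noncomputable def quadraticResultant {K : Type*} [Field K] (b c : K) (h : K[X]) : K :=
  (h %ₘ (X ^ 2 + C b * X + C c)).coeff 0 ^ 2 -
    b * (h %ₘ (X ^ 2 + C b * X + C c)).coeff 1 * (h %ₘ (X ^ 2 + C b * X + C c)).coeff 0 +
    c * (h %ₘ (X ^ 2 + C b * X + C c)).coeff 1 ^ 2

lemma monic_quadratic {K : Type*} [Field K] (b c : K) : (X ^ 2 + C b * X + C c : K[X]).Monic := by
  monicity!

lemma natDegree_monic_quadratic {K : Type*} [Field K] (b c : K) :
    (X ^ 2 + C b * X + C c : K[X]).natDegree = 2 := by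
  compute_degree!

lemma algebraMap_quadraticResultant {K L : Type*} [Field K] [Field L] [Algebra K L] {b c : K}
    {r₁ r₂ : L} (hb : algebraMap K L b = -(r₁ + r₂)) (hc : algebraMap K L c = r₁ * r₂) (h : K[X]) :
    algebraMap K L (quadraticResultant b c h) = aeval r₁ h * aeval r₂ h := by
  set f : K[X] := X ^ 2 + C b * X + C c with hf
  have hdeg : (h %ₘ f).natDegree < 2 := by
    rw [← natDegree_monic_quadratic b c]
    refine natDegree_modByMonic_lt h (monic_quadratic b c) fun h1 => ?_
    have := natDegree_monic_quadratic b c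
    rw [← hf, h1] at this
    simp at this
  have key : ∀ r : L, aeval r f = 0 → aeval r h =
      algebraMap K L ((h %ₘ f).coeff 0) + algebraMap K L ((h %ₘ f).coeff 1) * r := by
    intro r hr
    conv_lhs => rw [← modByMonic_add_div h f, (h %ₘ f).as_sum_range' 2 hdeg]
    simp [hr, Finset.sum_range_succ, aeval_monomial]
  have h1 : aeval r₁ f = 0 := by simp [hf, hb, hc]; ring
  have h2 : aeval r₂ f = 0 := by simp [hf, hb, hc]; ring
  rw [key r₁ h1, key r₂ h2, quadraticResultant, ← hf]
  simp only [map_add, map_sub, map_mul, map_pow, hb, hc]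
  ring

lemma exists_quadratic_roots {K : Type*} [Field K] (b c : K) : ∃ r₁ r₂ : AlgebraicClosure K,
    algebraMap K (AlgebraicClosure K) b = -(r₁ + r₂) ∧
      algebraMap K (AlgebraicClosure K) c = r₁ * r₂ := by
  obtain ⟨r, hr⟩ := IsAlgClosed.exists_aeval_eq_zero (AlgebraicClosure K)
    (X ^ 2 + C b * X + C c : K[X]) (by
      rw [degree_eq_natDegree (monic_quadratic b c).ne_zero, natDegree_monic_quadratic]; simp)
  refine ⟨r, -algebraMap K _ b - r, by ring, ?_⟩
  simp at hr
  linear_combination hr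

lemma quadraticResultant_mul {K : Type*} [Field K] (b c : K) (g h : K[X]) :
    quadraticResultant b c (g * h) = quadraticResultant b c g * quadraticResultant b c h := by
  obtain ⟨r₁, r₂, hb, hc⟩ := exists_quadratic_roots b c
  apply (algebraMap K (AlgebraicClosure K)).injective
  rw [map_mul]
  simp only [algebraMap_quadraticResultant hb hc, map_mul]
  ring

lemma quadraticResultant_one {K : Type*} [Field K] (b c : K) :
    quadraticResultant b c (1 : K[X]) = 1 := by
  obtain ⟨r₁, r₂, hb, hc⟩ := exists_quadratic_roots b c
  apply (algebraMap K (AlgebraicClosure K)).injective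
  simp [algebraMap_quadraticResultant hb hc]

lemma quadraticResultant_add_mul {K : Type*} [Field K] (b c : K) (h s : K[X]) :
    quadraticResultant b c (h + s * (X ^ 2 + C b * X + C c)) = quadraticResultant b c h := by
  simp only [quadraticResultant, add_modByMonic,
    (modByMonic_eq_zero_iff_dvd (monic_quadratic b c)).2 (dvd_mul_left _ s), add_zero]

lemma quadraticResultant_X_sub_C {K : Type*} [Field K] (b c x : K) :
    quadraticResultant b c (X - C x) = x ^ 2 + b * x + c := by
  obtain ⟨r₁, r₂, hb, hc⟩ := exists_quadratic_roots b c
  apply (algebraMap K (AlgebraicClosure K)).injective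
  simp [algebraMap_quadraticResultant hb hc, hb, hc]
  ring

/-- The completely multiplicative function on `K[X]` attached to the character sum
`∑ x, χ x * quadraticChar K (x ^ 2 + b * x + c)`. -/
noncomputable def quadraticTwist {K : Type*} [Field K] [Fintype K] [DecidableEq K]
    (b c : K) (χ : MulChar K ℂ) : K[X] →* ℂ where
  toFun h := χ (h.coeff 0) * (quadraticChar K (quadraticResultant b c h) : ℂ)
  map_one' := by simp [quadraticResultant_one]
  map_mul' g h := by
    simp only [mul_coeff_zero, map_mul, quadraticResultant_mul, Int.cast_mul]
    ring

lemma quadraticTwist_apply {K : Type*} [Field K] [Fintype K] [DecidableEq K]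
    (b c : K) (χ : MulChar K ℂ) (h : K[X]) : quadraticTwist b c χ h =
      χ (h.coeff 0) * (quadraticChar K (quadraticResultant b c h) : ℂ) := rfl

lemma sum_monicOfDegree_zero {K : Type*} [Field K] [Finite K] (ψ : K[X] →* ℂ) :
    ∑ h ∈ monicOfDegree K 0, ψ h = 1 := by
  have : monicOfDegree K 0 = {1} := by
    ext h
    rw [mem_monicOfDegree, Finset.mem_singleton]
    exact ⟨fun h1 => h1.1.natDegree_eq_zero.1 h1.2, by rintro rfl; simp⟩
  simp [this]

lemma sum_monicOfDegree_one {K : Type*} [Field K] [Fintype K] (ψ : K[X] →* ℂ) :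
    ∑ h ∈ monicOfDegree K 1, ψ h = ∑ x : K, ψ (X - C x) := by
  symm
  refine Finset.sum_bij (fun x _ => X - C x) ?_ ?_ ?_ fun _ _ => rfl
  · intro x _
    exact mem_monicOfDegree.2 ⟨monic_X_sub_C x, natDegree_X_sub_C x⟩
  · intro x _ y _ h
    simpa using h
  · intro h hh
    obtain ⟨h1, h2⟩ := mem_monicOfDegree.1 hh
    refine ⟨-h.coeff 0, Finset.mem_univ _, ?_⟩
    rw [h1.eq_X_add_C h2]
    simp

lemma sum_monicOfDegree_quadraticTwist_eq_zero {K : Type*} [Field K] [Fintype K] [DecidableEq K]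
    {b c : K} (hc : c ≠ 0) {χ : MulChar K ℂ} (hχ : χ ≠ 1) {n : ℕ} (hn : 3 ≤ n) :
    ∑ h ∈ monicOfDegree K n, quadraticTwist b c χ h = 0 := by
  set f : K[X] := X ^ 2 + C b * X + C c with hf
  have hfd : f.degree = 2 := by
    rw [degree_eq_natDegree (monic_quadratic b c).ne_zero, natDegree_monic_quadratic]; rfl
  have shift : ∀ s : K, ∑ h ∈ monicOfDegree K n, quadraticTwist b c χ h =
      ∑ h ∈ monicOfDegree K n, quadraticTwist b c χ (h + C s * f) := by
    intro s
    have mem : ∀ (t : K), ∀ h ∈ monicOfDegree K n, h + C t * f ∈ monicOfDegree K n := by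
      intro t h hh
      obtain ⟨h1, h2⟩ := mem_monicOfDegree.1 hh
      have hlt : (C t * f).degree < h.degree := by
        rw [degree_eq_natDegree h1.ne_zero, h2]
        rw [C_mul']
        refine (degree_smul_le t f).trans_lt ?_
        rw [hfd]
        exact_mod_cast hn
      exact mem_monicOfDegree.2 ⟨h1.add_of_left hlt, by
        rw [natDegree_add_eq_left_of_degree_lt hlt, h2]⟩
    symm
    refine Finset.sum_bij' (fun h _ => h + C s * f) (fun h _ => h + C (-s) * f)
      (mem s) (mem (-s)) ?_ ?_ fun _ _ => rfl
    · intro h _; simp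
    · intro h _; simp
  have h0 : (Fintype.card K : ℂ) * ∑ h ∈ monicOfDegree K n, quadraticTwist b c χ h = 0 := by
    have : (Fintype.card K : ℂ) * ∑ h ∈ monicOfDegree K n, quadraticTwist b c χ h =
        ∑ s : K, ∑ h ∈ monicOfDegree K n, quadraticTwist b c χ (h + C s * f) := by
      rw [← Finset.sum_congr rfl fun s _ => shift s]
      simp
    rw [this, Finset.sum_comm]
    refine Finset.sum_eq_zero fun h _ => ?_
    simp only [quadraticTwist_apply, hf, quadraticResultant_add_mul, ← Finset.sum_mul]
    rw [mul_eq_zero]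
    left
    have e : ∀ s : K, (h + C s * (X ^ 2 + C b * X + C c)).coeff 0 =
        ((Equiv.mulRight₀ c hc).trans (Equiv.addLeft (h.coeff 0))) s := by
      intro s; simp
    simp only [e]
    rw [Equiv.sum_comp ((Equiv.mulRight₀ c hc).trans (Equiv.addLeft (h.coeff 0))) (fun y => χ y)]
    exact MulChar.sum_eq_zero_of_ne_one hχ
  exact (mul_eq_zero.1 h0).resolve_left (by exact_mod_cast Fintype.card_ne_zero)

open IntermediateField in
lemma quadraticTwist_minpoly_pow {K E : Type*} [Field K] [Fintype K] [DecidableEq K] [Field E]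
    [Finite E] [Algebra K E] (b c : K) (χ : MulChar K ℂ) (x : E) :
    quadraticTwist b c χ (minpoly K x) ^ (Module.finrank K E / (minpoly K x).natDegree) =
      χ (Algebra.norm K (-x)) * (quadraticChar K
        (Algebra.norm K (x ^ 2 + algebraMap K E b * x + algebraMap K E c)) : ℂ) := by
  have hx : IsIntegral K x := IsIntegral.of_finite K x
  have hm : Module.finrank K E / (minpoly K x).natDegree = Module.finrank K⟮x⟯ E := by
    rw [← Module.finrank_mul_finrank K K⟮x⟯ E, adjoin.finrank hx]
    exact Nat.mul_div_cancel_left _ (minpoly.natDegree_pos hx)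
  have hP : (minpoly K x).map (algebraMap K (AlgebraicClosure K)) =
      (((minpoly K x).aroots (AlgebraicClosure K)).map fun r => X - C r).prod :=
    (IsAlgClosed.splits _).eq_prod_roots_of_monic ((minpoly.monic hx).map _)
  have hev : ∀ t : AlgebraicClosure K, aeval t (minpoly K x) =
      (((minpoly K x).aroots (AlgebraicClosure K)).map fun r => t - r).prod := by
    intro t
    rw [← eval_map_algebraMap, hP, eval_multiset_prod, Multiset.map_map]
    simp
  have h1 : Algebra.norm K (-x) = (minpoly K x).coeff 0 ^ Module.finrank K⟮x⟯ E := by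
    apply (algebraMap K (AlgebraicClosure K)).injective
    have := algebraMap_norm_aeval x (-X : K[X])
    rw [map_neg, aeval_X] at this
    rw [this, map_pow]
    congr 1
    have h0 := hev 0
    rw [← coeff_zero_eq_aeval_zero'] at h0
    rw [h0]
    simp
  have h2 : Algebra.norm K (x ^ 2 + algebraMap K E b * x + algebraMap K E c) =
      quadraticResultant b c (minpoly K x) ^ Module.finrank K⟮x⟯ E := by
    obtain ⟨r₁, r₂, hb, hc⟩ := exists_quadratic_roots b c
    apply (algebraMap K (AlgebraicClosure K)).injective
    have := algebraMap_norm_aeval x (X ^ 2 + C b * X + C c : K[X])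
    simp only [map_add, map_mul, map_pow, aeval_X, aeval_C] at this
    rw [this, map_pow, algebraMap_quadraticResultant hb hc, hev, hev, ← Multiset.prod_map_mul]
    congr 3
    ext r
    rw [hb, hc]
    ring
  rw [hm, quadraticTwist_apply, h1, h2, map_pow, map_pow, mul_pow]
  push_cast
  rfl

open scoped Classical in
lemma card_filter_minpoly_eq {K E : Type*} [Field K] [Finite K] [Field E] [Fintype E] [Algebra K E]
    {P : K[X]} (hP : P ∈ primesOfDegreeDvd K (Module.finrank K E)) :
    (Finset.univ.filter fun x : E => minpoly K x = P).card = P.natDegree := by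
  obtain ⟨hm, hi, hd⟩ := (mem_primesOfDegreeDvd Module.finrank_pos.ne').1 hP
  have hdvd := hi.natDegree_dvd_iff_dvd_X_pow_card_pow_sub_X.1 hd
  rw [← Module.natCard_eq_pow_finrank] at hdvd
  have hsplit : (P.map (algebraMap K E)).Splits := by
    have h := Polynomial.splits_X_pow_nat_card_sub_X (K := E)
    have hne : (X ^ Nat.card E - X : E[X]) ≠ 0 :=
      FiniteField.X_pow_card_sub_X_ne_zero E Finite.one_lt_card
    refine h.of_dvd hne ?_
    simpa using Polynomial.map_dvd (algebraMap K E) hdvd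
  have hsep : P.Separable := PerfectField.separable_of_irreducible hi
  rw [← card_rootSet_eq_natDegree hsep hsplit, ← Set.toFinset_card]
  congr 1
  ext x
  simp only [Finset.mem_filter, Finset.mem_univ, true_and, Set.mem_toFinset,
    mem_rootSet_of_ne hi.ne_zero]
  exact ⟨fun h => h ▸ minpoly.aeval K x, fun h => (minpoly.eq_of_irreducible_of_monic hi h hm).symm⟩

open scoped Classical in
lemma sum_primesOfDegreeDvd_eq {K E : Type*} [Field K] [Fintype K] [Field E] [Fintype E]
    [Algebra K E] (ψ : K[X] → ℂ) :
    ∑ P ∈ primesOfDegreeDvd K (Module.finrank K E), (P.natDegree : ℂ) *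
        ψ P ^ (Module.finrank K E / P.natDegree) =
      ∑ x : E, ψ (minpoly K x) ^ (Module.finrank K E / (minpoly K x).natDegree) := by
  rw [← Finset.sum_fiberwise_of_maps_to (s := Finset.univ) (g := fun x : E => minpoly K x)
    (t := primesOfDegreeDvd K (Module.finrank K E))]
  · refine Finset.sum_congr rfl fun P hP => ?_
    rw [Finset.sum_congr rfl (g := fun _ => ψ P ^ (Module.finrank K E / P.natDegree)),
      Finset.sum_const, card_filter_minpoly_eq hP, nsmul_eq_mul]
    intro x hx
    rw [(Finset.mem_filter.1 hx).2]
  · intro x _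
    have hx : IsIntegral K x := IsIntegral.of_finite K x
    exact (mem_primesOfDegreeDvd Module.finrank_pos.ne').2
      ⟨minpoly.monic hx, minpoly.irreducible hx, minpoly.degree_dvd hx⟩

lemma quadraticChar_norm {K E : Type*} [Field K] [Fintype K] [DecidableEq K] [Field E]
    [Fintype E] [DecidableEq E] [Algebra K E] (h2 : ringChar K ≠ 2) (x : E) :
    quadraticChar K (Algebra.norm K x) = quadraticChar E x := by
  have h2' : ringChar E ≠ 2 := by rwa [← Algebra.ringChar_eq K E]
  have key : algebraMap K E (quadraticChar K (Algebra.norm K x) : K) = (quadraticChar E x : E) := by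
    by_cases hx : x = 0
    · simp [hx]
    rw [quadraticChar_eq_pow_of_char_ne_two' h2, quadraticChar_eq_pow_of_char_ne_two' h2', map_pow,
      FiniteField.algebraMap_norm_eq_pow, ← pow_mul]
    congr 1
    rw [Nat.card_eq_fintype_card, Nat.card_eq_fintype_card]
    have hodd := FiniteField.odd_card_of_char_ne_two h2
    have hdvd : Fintype.card K - 1 ∣ Fintype.card E - 1 := by
      rw [Module.card_eq_pow_finrank (K := K) (V := E)]
      simpa using Nat.sub_dvd_pow_sub_pow (Fintype.card K) 1 (Module.finrank K E)
    have hodd' := FiniteField.odd_card_of_char_ne_two h2'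
    obtain ⟨d, hd⟩ := hdvd
    have hK : 1 < Fintype.card K := Fintype.one_lt_card
    rw [hd, Nat.mul_div_cancel_left _ (by omega)]
    obtain ⟨r, hr⟩ : ∃ r, Fintype.card K = 2 * r + 1 := ⟨Fintype.card K / 2, by omega⟩
    have hE : Fintype.card E = 2 * (r * d) + 1 := by
      have : 0 < Fintype.card E := Fintype.card_pos
      rw [hr, Nat.add_sub_cancel, mul_assoc] at hd
      omega
    rw [hE, hr, show (2 * r + 1) / 2 = r by omega, show (2 * (r * d) + 1) / 2 = r * d by omega,
      mul_comm]
  rw [map_intCast] at key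
  exact Int.cast_injOn_of_ringChar_ne_two h2' (quadraticChar_isQuadratic K _)
    (quadraticChar_isQuadratic E _) key

lemma le_one_of_pow_le {r C : ℝ} {m₀ : ℕ} (h : ∀ m ≥ m₀, r ^ m ≤ C) : r ≤ 1 := by
  by_contra! hr
  obtain ⟨n, hn⟩ := pow_unbounded_of_one_lt C hr
  exact (hn.trans_le (pow_le_pow_right₀ hr.le (le_max_left n m₀))).not_ge (h _ (le_max_right n m₀))

lemma norm_le_one_of_norm_pow_add_pow_le {u v : ℂ} {C : ℝ} {m₀ : ℕ}
    (h : ∀ m ≥ m₀, ‖u ^ m + v ^ m‖ ≤ C) : ‖u‖ ≤ 1 := by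
  have huv : ‖u‖ * ‖v‖ ≤ 1 := by
    rw [← norm_mul]
    refine le_one_of_pow_le (C := C ^ 2 + C) (m₀ := m₀) fun m hm => ?_
    have h1 := h m hm
    have h2 := h (2 * m) (by omega)
    have e : 2 * (u * v) ^ m = (u ^ m + v ^ m) ^ 2 - (u ^ (2 * m) + v ^ (2 * m)) := by
      rw [mul_comm 2 m, pow_mul, pow_mul]; ring
    have h3 : 2 * ‖u * v‖ ^ m ≤ C ^ 2 + C := by
      calc 2 * ‖u * v‖ ^ m = ‖2 * (u * v) ^ m‖ := by simp
        _ ≤ ‖(u ^ m + v ^ m) ^ 2‖ + ‖u ^ (2 * m) + v ^ (2 * m)‖ := by rw [e]; exact norm_sub_le _ _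
        _ ≤ C ^ 2 + C := by
          rw [norm_pow]
          exact add_le_add (pow_le_pow_left₀ (norm_nonneg _) h1 2) h2
    nlinarith [pow_nonneg (norm_nonneg (u * v)) m]
  by_contra! hu
  have hv : ‖v‖ ≤ 1 := by
    by_contra! hv
    nlinarith
  refine hu.not_ge (le_one_of_pow_le (C := C + 1) (m₀ := m₀) fun m hm => ?_)
  rw [← norm_pow]
  calc ‖u ^ m‖ = ‖(u ^ m + v ^ m) - v ^ m‖ := by ring_nf
    _ ≤ ‖u ^ m + v ^ m‖ + ‖v ^ m‖ := norm_sub_le _ _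
    _ ≤ C + 1 := add_le_add (h m hm) (by rw [norm_pow]; exact pow_le_one₀ (norm_nonneg _) hv)

lemma norm_le_sqrt_of_norm_pow_add_pow_le {α β : ℂ} {q C : ℝ} {m₀ : ℕ} (hq : 0 < q)
    (h : ∀ m ≥ m₀, ‖α ^ (2 * m) + β ^ (2 * m)‖ ≤ C * q ^ m) : ‖α‖ ≤ √q := by
  have h1 : ‖α ^ 2 / q‖ ≤ 1 := by
    refine norm_le_one_of_norm_pow_add_pow_le (v := β ^ 2 / q) (C := C) (m₀ := m₀) fun m hm => ?_
    have e : (α ^ 2 / q) ^ m + (β ^ 2 / q) ^ m = (α ^ (2 * m) + β ^ (2 * m)) / (q ^ m : ℝ) := by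
      push_cast
      rw [div_pow, div_pow, ← pow_mul, ← pow_mul, add_div]
    rw [e, norm_div, Complex.norm_real, norm_pow, Real.norm_of_nonneg hq.le,
      div_le_iff₀ (pow_pos hq m)]
    exact h m hm
  rw [norm_div, norm_pow, Complex.norm_real, Real.norm_of_nonneg hq.le, div_le_one hq] at h1
  exact Real.le_sqrt_of_sq_le h1

lemma eq_neg_pow_add_pow_of_recurrence {a c : ℕ → ℂ} {α β : ℂ} (h0 : a 0 = 1)
    (h1 : a 1 = -(α + β)) (h2 : a 2 = α * β) (h3 : ∀ n, 3 ≤ n → a n = 0)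
    (hrec : ∀ n : ℕ, (n : ℂ) * a n = ∑ k ∈ Finset.Icc 1 n, c k * a (n - k)) {n : ℕ} (hn : n ≠ 0) :
    c n = -(α ^ n + β ^ n) := by
  induction n using Nat.strong_induction_on with
  | _ n ih =>
  match n, hn with
  | 1, _ =>
    have := hrec 1
    simp [h0] at this
    rw [← this, h1]; ring
  | 2, _ =>
    have := hrec 2
    rw [Finset.sum_Icc_succ_top (by norm_num)] at this
    simp only [h0, h1, h2, Finset.Icc_self, Finset.sum_singleton, ih 1 (by norm_num) (by norm_num)] at this
    norm_num [h0, h1, h2] at this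
    linear_combination -this
  | m + 3, _ =>
    have := hrec (m + 3)
    rw [Finset.sum_Icc_succ_top (by omega), Finset.sum_Icc_succ_top (by omega),
      Finset.sum_Icc_succ_top (by omega), Finset.sum_eq_zero] at this
    · rw [h3 _ (by omega), show m + 2 + 1 - (m + 2 + 1) = 0 by omega,
        show m + 2 + 1 - (m + 1 + 1) = 1 by omega, show m + 2 + 1 - (m + 1) = 2 by omega,
        h0, h1, h2, ih (m + 1) (by omega) (by omega), ih (m + 1 + 1) (by omega) (by omega)] at this
      rw [show m + 3 = m + 2 + 1 by rfl]
      linear_combination -this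
    · intro k hk
      rw [Finset.mem_Icc] at hk
      rw [h3 _ (by omega), mul_zero]

lemma norm_sum_primesOfDegreeDvd_quadraticTwist_le {p m : ℕ} [Fact p.Prime] {E : Type*} [Field E]
    [Fintype E] [Algebra (ZMod p) E] (hfin : Module.finrank (ZMod p) E = 2 * m) (hp2 : p ≠ 2)
    (hpm : 4 * p + 1 ≤ p ^ m) {b c : ZMod p} (hc : c ≠ 0) (hD : b ^ 2 - 4 * c ≠ 0)
    (χ : MulChar (ZMod p) ℂ) :
    ‖∑ P ∈ primesOfDegreeDvd (ZMod p) (2 * m), (P.natDegree : ℂ) *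
      quadraticTwist b c χ P ^ (2 * m / P.natDegree)‖ ≤ (14 * p + 9) * (p : ℝ) ^ m := by
  classical
  have hr2 : ringChar (ZMod p) ≠ 2 := by rwa [ZMod.ringChar_zmod_n]
  have hcard : Fintype.card E = (p ^ m) ^ 2 := by
    rw [Module.card_eq_pow_finrank (K := ZMod p) (V := E), ZMod.card, hfin, ← pow_mul, mul_comm]
  have e := sum_primesOfDegreeDvd_eq (K := ZMod p) (E := E) (quadraticTwist b c χ)
  rw [hfin, ← Equiv.sum_comp (Equiv.neg _)] at e
  rw [e, Finset.sum_congr rfl (g := fun x : E => χ (Algebra.norm (ZMod p) x) *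
    (quadraticChar E (x ^ 2 + algebraMap _ _ (-b) * x + algebraMap _ _ c) : ℂ))]
  · exact norm_sum_norm_mul_quadraticChar_le hcard hp2 hpm hc (by simpa using hD) χ
  · intro x _
    have h := quadraticTwist_minpoly_pow b c χ (-x)
    rw [hfin, quadraticChar_norm hr2, neg_neg] at h
    rw [Equiv.neg_apply, h]
    simp

open scoped Classical in
/-- The Weil bound for the twisted quadratic character sum, in the nondegenerate case. -/
lemma norm_sum_mulChar_mul_quadraticChar_le_of_ne_zero {p : ℕ} [Fact p.Prime] (hp2 : p ≠ 2)
    {b c : ZMod p} (hc : c ≠ 0) (hD : b ^ 2 - 4 * c ≠ 0) {χ : MulChar (ZMod p) ℂ} (hχ : χ ≠ 1) :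
    ‖∑ x, χ x * (quadraticChar (ZMod p) (x ^ 2 + b * x + c) : ℂ)‖ ≤ 2 * √p := by
  have hp : p.Prime := Fact.out
  have hp3 : 3 ≤ p := by have := hp.two_le; omega
  have hr2 : ringChar (ZMod p) ≠ 2 := by rwa [ZMod.ringChar_zmod_n]
  set ψ := quadraticTwist b c χ with hψ
  set a : ℕ → ℂ := fun n => ∑ h ∈ monicOfDegree (ZMod p) n, ψ h with ha
  set S : ℕ → ℂ := fun k => ∑ P ∈ primesOfDegreeDvd (ZMod p) k, (P.natDegree : ℂ) *
    ψ P ^ (k / P.natDegree) with hS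
  obtain ⟨d, hd⟩ := IsAlgClosed.exists_pow_nat_eq (a 1 ^ 2 - 4 * a 2) two_pos
  set α : ℂ := (-a 1 + d) / 2 with hα
  set β : ℂ := (-a 1 - d) / 2 with hβ
  have h1 : a 1 = -(α + β) := by rw [hα, hβ]; ring
  have h2 : a 2 = α * β := by rw [hα, hβ]; linear_combination (1 / 4) * hd
  have hrec : ∀ n, n ≠ 0 → S n = -(α ^ n + β ^ n) := fun n hn =>
    eq_neg_pow_add_pow_of_recurrence (a := a) (sum_monicOfDegree_zero ψ) h1 h2
      (fun n hn => sum_monicOfDegree_quadraticTwist_eq_zero hc hχ hn)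
      (fun n => mul_sum_monicOfDegree ψ n) hn
  have hbound : ∀ m ≥ 3, ‖α ^ (2 * m) + β ^ (2 * m)‖ ≤ (14 * p + 9) * (p : ℝ) ^ m := by
    intro m hm
    rw [← norm_neg, ← hrec (2 * m) (by omega)]
    have : Fintype (GaloisField p (2 * m)) := Fintype.ofFinite _
    refine norm_sum_primesOfDegreeDvd_quadraticTwist_le (E := GaloisField p (2 * m))
      (GaloisField.finrank p (by omega)) hp2 ?_ hc hD χ
    calc 4 * p + 1 ≤ p ^ 3 := by nlinarith [Nat.mul_le_mul hp3 hp3]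
      _ ≤ p ^ m := Nat.pow_le_pow_right (by omega) hm
  have hp0 : (0 : ℝ) < p := by exact_mod_cast hp.pos
  have hαb := norm_le_sqrt_of_norm_pow_add_pow_le hp0 hbound
  have hβb := norm_le_sqrt_of_norm_pow_add_pow_le (α := β) (β := α) hp0
    (by simpa only [add_comm] using hbound)
  have hsum : a 1 = χ (-1) * ∑ x, χ x * (quadraticChar (ZMod p) (x ^ 2 + b * x + c) : ℂ) := by
    rw [ha]
    simp only
    rw [sum_monicOfDegree_one, Finset.mul_sum]
    refine Finset.sum_congr rfl fun x _ => ?_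
    rw [hψ, quadraticTwist_apply, quadraticResultant_X_sub_C, ← mul_assoc, ← map_mul]
    simp
  have hneg : ‖χ (-1)‖ = 1 := by
    have : χ (-1) * χ (-1) = 1 := by rw [← map_mul]; simp
    have h := congrArg norm this
    rw [norm_mul, norm_one] at h
    nlinarith [norm_nonneg (χ (-1))]
  calc _ = ‖a 1‖ := by rw [hsum, norm_mul, hneg, one_mul]
    _ ≤ ‖α‖ + ‖β‖ := by rw [h1, norm_neg]; exact norm_add_le _ _
    _ ≤ 2 * √p := by linarith

lemma norm_jacobiSum_le {F : Type*} [Field F] [Fintype F] {χ φ : MulChar F ℂ} (hφ : φ ≠ 1)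
    (hχφ : χ * φ ≠ 1) : ‖jacobiSum χ φ‖ ≤ √(Fintype.card F) := by
  classical
  by_cases hχ : χ = 1
  · rw [hχ, jacobiSum_one_nontrivial hφ, norm_neg, norm_one, Real.one_le_sqrt]
    exact_mod_cast Fintype.card_pos
  have hchar : ringChar ℂ ≠ ringChar F := by
    rw [ringChar.eq_zero]
    exact (CharP.ringChar_ne_zero_of_finite F).symm
  have h := jacobiSum_mul_jacobiSum_inv hchar hχ hφ hχφ
  have hstar : jacobiSum χ⁻¹ φ⁻¹ = star (jacobiSum χ φ) := by
    simp only [jacobiSum, star_sum, star_mul', MulChar.star_apply']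
  rw [hstar] at h
  have h2 : ‖jacobiSum χ φ‖ ^ 2 = Fintype.card F := by
    have := congrArg norm h
    rw [norm_mul, norm_star, Complex.norm_natCast] at this
    rw [sq, this]
  exact Real.le_sqrt_of_sq_le h2.le

lemma norm_quadraticChar_eq_one {F : Type*} [Field F] [Fintype F] [DecidableEq F] {a : F}
    (ha : a ≠ 0) : ‖(quadraticChar F a : ℂ)‖ = 1 := by
  rcases quadraticChar_dichotomy ha with h | h <;> simp [h]

lemma norm_sum_mulChar_mul_quadraticChar_le_of_eq_zero {F : Type*} [Field F] [Fintype F]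
    [DecidableEq F] (h2 : ringChar F ≠ 2) {a b : F} (ha : a ≠ 0) (hb : b ≠ 0) {χ : MulChar F ℂ}
    (hχ : χ ≠ 1) :
    ‖∑ x, χ x * (quadraticChar F (a * x ^ 2 + b * x) : ℂ)‖ ≤ √(Fintype.card F) := by
  set η : MulChar F ℂ := (quadraticChar F).ringHomComp (Int.castRingHom ℂ) with hη
  have hη' : ∀ x, (quadraticChar F x : ℂ) = η x := fun x => rfl
  have hη1 : η ≠ 1 := (MulChar.ringHomComp_ne_one_iff (RingHom.injective_int _)).2
    (quadraticChar_ne_one h2)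
  have hηη : η * η = 1 := by
    rw [← sq, hη, ((quadraticChar_isQuadratic F).comp _).sq_eq_one]
  set t : F := -(b / a) with ht
  have ht0 : t ≠ 0 := by simp [ht, ha, hb]
  have key : ∑ x, χ x * (quadraticChar F (a * x ^ 2 + b * x) : ℂ) =
      (χ t * η t * η b) * jacobiSum (χ * η) η := by
    rw [jacobiSum, Finset.mul_sum, ← Equiv.sum_comp (Equiv.mulLeft₀ t ht0)]
    refine Finset.sum_congr rfl fun y _ => ?_
    have e : a * (t * y) ^ 2 + b * (t * y) = t * b * y * (1 - y) := by
      rw [ht]; field_simp; ring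
    simp only [Equiv.mulLeft₀_apply, e, map_mul, MulChar.mul_apply, Int.cast_mul, hη']
    ring
  rw [key, norm_mul]
  have hle := norm_jacobiSum_le (χ := χ * η) hη1 (by rwa [mul_assoc, hηη, mul_one])
  refine (mul_le_of_le_one_left (norm_nonneg _) ?_).trans hle
  rw [norm_mul, norm_mul]
  refine mul_le_one₀ (mul_le_one₀ ?_ (norm_nonneg _) ?_) (norm_nonneg _) ?_ <;>
  exact norm_mulChar_le_one _ _

lemma norm_sum_mulChar_mul_quadraticChar_le {p : ℕ} [Fact p.Prime] (hp2 : p ≠ 2)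
    {a b c : ZMod p} (ha : a ≠ 0) (hD : b ^ 2 - 4 * a * c ≠ 0) {χ : MulChar (ZMod p) ℂ}
    (hχ : χ ≠ 1) :
    ‖∑ x, χ x * (quadraticChar (ZMod p) (a * x ^ 2 + b * x + c) : ℂ)‖ ≤ 2 * √p := by
  by_cases hc : c = 0
  · subst hc
    have h := norm_sum_mulChar_mul_quadraticChar_le_of_eq_zero (by rwa [ZMod.ringChar_zmod_n]) ha
      (b := b) (by rintro rfl; simp at hD) hχ
    simp only [add_zero]
    rw [ZMod.card] at h
    linarith [Real.sqrt_nonneg (p : ℝ)]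
  · have h := norm_sum_mulChar_mul_quadraticChar_le_of_ne_zero hp2 (b := b / a) (c := c / a)
      (div_ne_zero hc ha) (by
        intro h
        apply hD
        field_simp at h
        linear_combination h) hχ
    have e : ∑ x, χ x * (quadraticChar (ZMod p) (a * x ^ 2 + b * x + c) : ℂ) =
        (quadraticChar (ZMod p) a : ℂ) *
          ∑ x, χ x * (quadraticChar (ZMod p) (x ^ 2 + b / a * x + c / a) : ℂ) := by
      rw [Finset.mul_sum]
      refine Finset.sum_congr rfl fun x _ => ?_
      rw [mul_left_comm, ← Int.cast_mul, ← map_mul]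
      congr 4
      field_simp
    rw [e, norm_mul, norm_quadraticChar_eq_one ha, one_mul]
    exact h

lemma sum_comp_sq {F : Type*} [Field F] [Fintype F] [DecidableEq F] (h2 : ringChar F ≠ 2)
    (g : F → ℤ) : ∑ y, g (y ^ 2) = ∑ z, (quadraticChar F z + 1) * g z := by
  rw [← Finset.sum_fiberwise_of_maps_to (s := Finset.univ) (g := fun y : F => y ^ 2)
    (t := Finset.univ) (fun _ _ => Finset.mem_univ _)]
  refine Finset.sum_congr rfl fun z _ => ?_
  rw [Finset.sum_congr rfl (g := fun _ => g z) fun y hy => by rw [(Finset.mem_filter.1 hy).2],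
    Finset.sum_const, nsmul_eq_mul, ← quadraticChar_card_sqrts h2]
  congr 3
  ext; simp

lemma sum_quadraticChar_quadratic {F : Type*} [Field F] [Fintype F] [DecidableEq F]
    (h2 : ringChar F ≠ 2) {a b c : F} (ha : a ≠ 0) (hD : b ^ 2 - 4 * a * c ≠ 0) :
    ∑ x, quadraticChar F (a * x ^ 2 + b * x + c) = -quadraticChar F a := by
  set D := b ^ 2 - 4 * a * c with hDdef
  set η := quadraticChar F with hη
  have h2' : (2 : F) ≠ 0 := Ring.two_ne_zero h2
  have hη1 : η ≠ 1 := quadraticChar_ne_one h2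
  have hsq : ∀ z : F, z ≠ 0 → η z * η z = 1 := fun z hz => by
    rw [← sq]; exact quadraticChar_sq_one hz
  have hpair : ∑ z, η z * η (z - D) = -1 := by
    have hJ := jacobiSum_nontrivial_inv hη1
    rw [(quadraticChar_isQuadratic F).inv] at hJ
    have : ∑ z, η z * η (z - D) = η (-1) * jacobiSum η η := by
      rw [jacobiSum, Finset.mul_sum, ← Equiv.sum_comp (Equiv.mulLeft₀ D hD)]
      refine Finset.sum_congr rfl fun w _ => ?_
      rw [Equiv.mulLeft₀_apply, show D * w - D = D * (-1) * (1 - w) by ring, map_mul, map_mul,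
        map_mul]
      linear_combination (η w * η (-1) * η (1 - w)) * hsq D hD
    rw [this, hJ]
    linear_combination -hsq (-1) (by simp)
  have hshift : ∑ z, η (z - D) = 0 := by
    exact (Equiv.sum_comp (Equiv.subRight D) fun z => η z).trans
      (MulChar.sum_eq_zero_of_ne_one hη1)
  have hmain : ∑ y, η (y ^ 2 - D) = -1 := by
    rw [sum_comp_sq h2 fun z => η (z - D)]
    simp only [add_mul, one_mul, Finset.sum_add_distrib]
    rw [hpair, hshift, add_zero]
  have hcomp : ∑ x, η (a * x ^ 2 + b * x + c) = η a * ∑ y, η (y ^ 2 - D) := by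
    rw [← Equiv.sum_comp ((Equiv.mulLeft₀ (2 * a) (mul_ne_zero h2' ha)).trans (Equiv.addRight b))
      (fun y => η (y ^ 2 - D)), Finset.mul_sum]
    refine Finset.sum_congr rfl fun x _ => ?_
    simp only [Equiv.trans_apply, Equiv.mulLeft₀_apply, Equiv.coe_addRight]
    rw [show (2 * a * x + b) ^ 2 - D = (2 * 2) * a * (a * x ^ 2 + b * x + c) by rw [hDdef]; ring,
      map_mul, map_mul, map_mul, hsq 2 h2']
    linear_combination (-η (a * x ^ 2 + b * x + c)) * hsq a ha
  rw [hcomp, hmain]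
  ring

/-- The function detecting, for a character `χ` of order `q`, the units with `χ x ≠ 1`. -/
noncomputable def nontrivialIndicator {F : Type*} [Field F] (χ : MulChar F ℂ) (q : ℕ) (x : F) : ℂ :=
  1 - (q : ℂ)⁻¹ * ∑ j ∈ Finset.range q, χ x ^ j

lemma nontrivialIndicator_of_eq_one {F : Type*} [Field F] {χ : MulChar F ℂ} {q : ℕ} (hq : q ≠ 0)
    {x : F} (h : χ x = 1) : nontrivialIndicator χ q x = 0 := by
  have : (q : ℂ) ≠ 0 := by exact_mod_cast hq
  simp [nontrivialIndicator, h, this]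

lemma nontrivialIndicator_of_ne_one {F : Type*} [Field F] {χ : MulChar F ℂ} {q : ℕ}
    (hχ : χ ^ q = 1) {x : F} (hx : x ≠ 0) (h : χ x ≠ 1) : nontrivialIndicator χ q x = 1 := by
  have hpow : χ x ^ q = 1 := by
    rcases Nat.eq_zero_or_pos q with rfl | hq
    · simp
    rw [← MulChar.pow_apply' χ hq.ne', hχ, MulChar.one_apply hx.isUnit]
  have : ∑ j ∈ Finset.range q, χ x ^ j = 0 := by
    have := mul_neg_geom_sum (χ x) q
    rw [hpow, sub_self] at this
    exact (mul_eq_zero.1 this).resolve_left (sub_ne_zero.2 h.symm)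
  simp [nontrivialIndicator, this]

lemma mulChar_mul_nontrivialIndicator {F : Type*} [Field F] (χ ψ : MulChar F ℂ) {q : ℕ}
    (hq : 0 < q) (x : F) : ψ x * nontrivialIndicator χ q x =
      (1 - (q : ℂ)⁻¹) * ψ x - (q : ℂ)⁻¹ * ∑ j ∈ Finset.Ico 1 q, (ψ * χ ^ j) x := by
  have h1 : ∑ j ∈ Finset.range q, χ x ^ j = 1 + ∑ j ∈ Finset.Ico 1 q, χ x ^ j := by
    rw [Finset.range_eq_Ico, Finset.sum_eq_sum_Ico_succ_bot hq, pow_zero]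
  have h2 : ∑ j ∈ Finset.Ico 1 q, (ψ * χ ^ j) x = ψ x * ∑ j ∈ Finset.Ico 1 q, χ x ^ j := by
    rw [Finset.mul_sum]
    refine Finset.sum_congr rfl fun j hj => ?_
    rw [MulChar.mul_apply, MulChar.pow_apply' χ (by rw [Finset.mem_Ico] at hj; omega)]
  rw [nontrivialIndicator, h1, h2]
  ring

lemma norm_sum_mulChar_mul_prod_nontrivialIndicator_le {F : Type*} [Field F] [Fintype F]
    (w : F → ℂ) {B : ℝ} (hw : ∀ χ : MulChar F ℂ, χ ≠ 1 → ‖∑ x, χ x * w x‖ ≤ B)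
    (X : ℕ → MulChar F ℂ) (s : Finset ℕ) (hs : ∀ q ∈ s, q.Prime) (hX : ∀ q ∈ s, orderOf (X q) = q) :
    (∀ (χ : MulChar F ℂ) (k : ℕ), χ ^ k = 1 → (∀ q ∈ s, k.Coprime q) → χ ≠ 1 →
      ‖∑ x, χ x * ((∏ q ∈ s, nontrivialIndicator (X q) q x) * w x)‖ ≤
        (∏ q ∈ s, (1 - (q : ℝ)⁻¹)) * 2 ^ s.card * B) ∧
    ‖∑ x, (1 : MulChar F ℂ) x * ((∏ q ∈ s, nontrivialIndicator (X q) q x) * w x) -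
        (∏ q ∈ s, (1 - (q : ℂ)⁻¹)) * ∑ x, (1 : MulChar F ℂ) x * w x‖ ≤
      (∏ q ∈ s, (1 - (q : ℝ)⁻¹)) * (2 ^ s.card - 1) * B := by
  induction s using Finset.induction_on with
  | empty => simpa using fun χ _ _ hχ => hw χ hχ
  | insert q s hqs ih =>
    obtain ⟨ih1, ih2⟩ := ih (fun r hr => hs r (Finset.mem_insert_of_mem hr))
      (fun r hr => hX r (Finset.mem_insert_of_mem hr))
    have hq : q.Prime := hs q (Finset.mem_insert_self _ _)
    have hXq : orderOf (X q) = q := hX q (Finset.mem_insert_self _ _)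
    have hq0 : (q : ℝ) ≠ 0 := by exact_mod_cast hq.ne_zero
    set θ : ℝ := ∏ r ∈ s, (1 - (r : ℝ)⁻¹) with hθ
    have hq1 : 0 ≤ 1 - (q : ℝ)⁻¹ := by
      rw [sub_nonneg]
      exact inv_le_one_of_one_le₀ (by exact_mod_cast hq.one_le)
    have hn1 : ‖1 - (q : ℂ)⁻¹‖ = 1 - (q : ℝ)⁻¹ := by
      rw [show (1 - (q : ℂ)⁻¹) = ((1 - (q : ℝ)⁻¹ : ℝ) : ℂ) by push_cast; rfl, Complex.norm_real,
        Real.norm_of_nonneg hq1]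
    have hn2 : ‖(q : ℂ)⁻¹‖ = (q : ℝ)⁻¹ := by simp
    have hexp : ∀ ψ : MulChar F ℂ, ∑ x, ψ x * ((∏ r ∈ insert q s, nontrivialIndicator (X r) r x) *
        w x) = (1 - (q : ℂ)⁻¹) * (∑ x, ψ x * ((∏ r ∈ s, nontrivialIndicator (X r) r x) * w x)) -
        (q : ℂ)⁻¹ * ∑ j ∈ Finset.Ico 1 q, ∑ x, (ψ * X q ^ j) x *
          ((∏ r ∈ s, nontrivialIndicator (X r) r x) * w x) := by
      intro ψ
      rw [Finset.sum_comm, Finset.mul_sum, Finset.mul_sum, ← Finset.sum_sub_distrib]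
      refine Finset.sum_congr rfl fun x _ => ?_
      rw [Finset.prod_insert hqs, ← Finset.sum_mul]
      linear_combination ((∏ r ∈ s, nontrivialIndicator (X r) r x) * w x) *
        mulChar_mul_nontrivialIndicator (X q) ψ hq.pos x
    have htail : ∀ (ψ : MulChar F ℂ) (k : ℕ), ψ ^ k = 1 → (∀ r ∈ insert q s, k.Coprime r) →
        ‖(q : ℂ)⁻¹ * ∑ j ∈ Finset.Ico 1 q, ∑ x, (ψ * X q ^ j) x *
          ((∏ r ∈ s, nontrivialIndicator (X r) r x) * w x)‖ ≤
        (1 - (q : ℝ)⁻¹) * (θ * 2 ^ s.card * B) := by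
      intro ψ k hψ hk
      rw [norm_mul, hn2]
      have hterm : ∀ j ∈ Finset.Ico 1 q, ‖∑ x, (ψ * X q ^ j) x *
          ((∏ r ∈ s, nontrivialIndicator (X r) r x) * w x)‖ ≤ θ * 2 ^ s.card * B := by
        intro j hj
        rw [Finset.mem_Ico] at hj
        refine ih1 _ (k * q) ?_ ?_ ?_
        · rw [mul_pow, pow_mul, hψ, one_pow, one_mul, mul_comm k q, ← pow_mul, mul_comm j, mul_assoc,
            pow_mul]
          nth_rewrite 2 [← hXq]
          rw [pow_orderOf_eq_one, one_pow]
        · intro r hr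
          refine (hk r (Finset.mem_insert_of_mem hr)).mul_left ?_
          refine (Nat.coprime_primes hq (hs r (Finset.mem_insert_of_mem hr))).2 ?_
          rintro rfl
          exact hqs hr
        · intro h
          have hjk : X q ^ (j * k) = 1 := by
            have := congrArg (· ^ k) h
            simpa [mul_pow, hψ, ← pow_mul] using this
          have hd := orderOf_dvd_of_pow_eq_one hjk
          rw [hXq] at hd
          rcases hq.dvd_mul.1 hd with h1 | h1
          · exact absurd (Nat.le_of_dvd (by omega) h1) (by omega)
          · exact hq.one_lt.ne' (Nat.dvd_one.1
              ((hk q (Finset.mem_insert_self _ _)) ▸ Nat.dvd_gcd h1 dvd_rfl))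
      calc (q : ℝ)⁻¹ * ‖_‖ ≤ (q : ℝ)⁻¹ * ((Finset.Ico 1 q).card • (θ * 2 ^ s.card * B)) := by
            gcongr
            exact (norm_sum_le _ _).trans (Finset.sum_le_card_nsmul _ _ _ hterm)
        _ = (1 - (q : ℝ)⁻¹) * (θ * 2 ^ s.card * B) := by
            rw [Nat.card_Ico, nsmul_eq_mul, Nat.cast_sub hq.one_le]
            field_simp
            push_cast
            ring
    rw [Finset.prod_insert hqs, Finset.prod_insert hqs, Finset.card_insert_of_notMem hqs, ← hθ]
    constructor
    · intro χ k hχ hk hχ1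
      rw [hexp]
      refine (norm_sub_le _ _).trans ?_
      rw [norm_mul, hn1]
      have h1 := mul_le_mul_of_nonneg_left
        (ih1 χ k hχ (fun r hr => hk r (Finset.mem_insert_of_mem hr)) hχ1) hq1
      have h2 := htail χ k hχ hk
      rw [pow_succ]
      linarith
    · rw [hexp]
      have h1 := mul_le_mul_of_nonneg_left ih2 hq1
      have h2 := htail 1 1 (one_pow _) (fun r _ => Nat.coprime_one_left r)
      rw [← hn1, ← norm_mul, hn1] at h1
      rw [show ∀ u v t P z : ℂ, u * v - t - u * P * z = u * (v - P * z) - t by intros; ring]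
      refine (norm_sub_le _ _).trans ((add_le_add h1 h2).trans (le_of_eq ?_))
      rw [pow_succ]
      ring

lemma exists_pow_eq_of_pow_div_ne_one {p : ℕ} [Fact p.Prime] {g : ZMod p} (hg : g ≠ 0)
    (h : ∀ q : ℕ, q.Prime → q ∣ p - 1 → g ^ ((p - 1) / q) ≠ 1) (y : ZMod p) (hy : y ≠ 0) :
    ∃ n : ℕ, g ^ n = y := by
  have hp : p.Prime := Fact.out
  have ho : orderOf (Units.mk0 g hg) = Nat.card (ZMod p)ˣ := by
    rw [Nat.card_eq_fintype_card, ZMod.card_units]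
    refine orderOf_eq_of_pow_and_pow_div_prime (by have := hp.two_le; omega) ?_ ?_
    · exact Units.ext (by simpa using ZMod.pow_card_sub_one_eq_one hg)
    · intro q hq hd h1
      exact h q hq hd (by simpa using congrArg Units.val h1)
  have hm : Units.mk0 y hy ∈ Submonoid.powers (Units.mk0 g hg) := by
    rw [mem_powers_iff_mem_zpowers, Subgroup.eq_top_of_card_eq _ ((Nat.card_zpowers _).trans ho)]
    exact Subgroup.mem_top _
  obtain ⟨n, hn⟩ := hm
  exact ⟨n, by simpa using congrArg Units.val hn⟩

lemma exists_pow_eq_of_pow_div_eq_one {p : ℕ} [Fact p.Prime] {g : ZMod p} (hg : g ≠ 0) {q : ℕ}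
    (hq : 0 < q) (hd : q ∣ p - 1) (h : g ^ ((p - 1) / q) = 1) : ∃ y : ZMod p, y ^ q = g := by
  have hp : p.Prime := Fact.out
  obtain ⟨ζ, hζ⟩ := IsCyclic.exists_generator (α := (ZMod p)ˣ)
  have hζo : orderOf ζ = p - 1 := by
    rw [orderOf_eq_card_of_forall_mem_zpowers hζ, Nat.card_eq_fintype_card, ZMod.card_units]
  obtain ⟨i, hi⟩ := mem_powers_iff_mem_zpowers.2 (hζ (Units.mk0 g hg))
  have h1 : ζ ^ (i * ((p - 1) / q)) = 1 := by
    rw [pow_mul]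
    refine Units.ext ?_
    have : ζ ^ i = Units.mk0 g hg := hi
    rw [this]
    simpa using h
  have h2 := orderOf_dvd_of_pow_eq_one h1
  rw [hζo] at h2
  obtain ⟨d, hd⟩ := hd
  rw [hd, Nat.mul_div_cancel_left _ hq] at h2
  have hd0 : 0 < d := by
    rcases Nat.eq_zero_or_pos d with rfl | hd0
    · have := hp.two_le; omega
    · exact hd0
  obtain ⟨j, rfl⟩ := Nat.dvd_of_mul_dvd_mul_right hd0 h2
  refine ⟨(ζ ^ j : (ZMod p)ˣ), ?_⟩
  have : ζ ^ (q * j) = Units.mk0 g hg := hi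
  have := congrArg Units.val this
  rw [mul_comm, pow_mul] at this
  simpa using this

lemma card_filter_quadratic_eq_zero_le {F : Type*} [Field F] [Fintype F] [DecidableEq F] {a : F}
    (ha : a ≠ 0) (b c : F) :
    (Finset.univ.filter fun x : F => a * x ^ 2 + b * x + c = 0).card ≤ 2 := by
  have hdeg : (C a * X ^ 2 + C b * X + C c : F[X]).natDegree = 2 := natDegree_quadratic ha
  have hne : (C a * X ^ 2 + C b * X + C c : F[X]) ≠ 0 := by
    intro h; rw [h] at hdeg; simp at hdeg
  calc _ ≤ (C a * X ^ 2 + C b * X + C c : F[X]).roots.toFinset.card := by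
        refine Finset.card_le_card fun x hx => ?_
        rw [Multiset.mem_toFinset, mem_roots hne]
        simpa using hx
    _ ≤ _ := Multiset.toFinset_card_le _
    _ ≤ 2 := (card_roots' _).trans hdeg.le

lemma one_le_prod_one_sub_inv_mul_two_pow (s : Finset ℕ) (hs : ∀ q ∈ s, q.Prime) :
    1 ≤ (∏ q ∈ s, (1 - (q : ℝ)⁻¹)) * 2 ^ s.card := by
  rw [← Finset.prod_const, ← Finset.prod_mul_distrib]
  refine Finset.one_le_prod fun q hq => ?_
  have : (q : ℝ)⁻¹ ≤ 2⁻¹ := inv_anti₀ two_pos (by exact_mod_cast (hs q hq).two_le)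
  linarith

/-- The conclusion of the theorem for primes large compared to the number of prime factors
of `p - 1`. -/
lemma exists_of_four_pow_le {p : ℕ} [Fact p.Prime] (hp2 : 2 < p)
    (hω : 4 ^ ((p - 1).primeFactors.card + 1) ≤ p) {a b c : ZMod p} (ha : a ≠ 0)
    (hD : b ^ 2 - 4 * a * c ≠ 0) :
    ∃ g : ZMod p, (∀ y : ZMod p, y ≠ 0 → ∃ n : ℕ, g ^ n = y) ∧
      ∃ y : ZMod p, y ≠ 0 ∧ y ^ 2 = a * g ^ 2 + b * g + c := by
  by_contra! hno
  have hr2 : ringChar (ZMod p) ≠ 2 := by rw [ZMod.ringChar_zmod_n]; exact hp2.ne'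
  set s := (p - 1).primeFactors with hs
  have hsp : ∀ q ∈ s, q.Prime := fun q hq => Nat.prime_of_mem_primeFactors hq
  have hsd : ∀ q ∈ s, q ∣ p - 1 := fun q hq => Nat.dvd_of_mem_primeFactors hq
  have hchar : ∀ q : ℕ, ∃ χ : MulChar (ZMod p) ℂ, q ∈ s → orderOf χ = q := by
    intro q
    by_cases hq : q ∈ s
    · obtain ⟨χ, hχ⟩ := MulChar.exists_mulChar_orderOf (ZMod p) (n := q)
        (by rw [ZMod.card]; exact hsd q hq) (Complex.isPrimitiveRoot_exp q (hsp q hq).ne_zero)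
      exact ⟨χ, fun _ => hχ⟩
    · exact ⟨1, fun h => absurd h hq⟩
  choose X hX using hchar
  set w : ZMod p → ℂ := fun x => 1 + (quadraticChar (ZMod p) (a * x ^ 2 + b * x + c) : ℂ) with hwdef
  have hw : ∀ χ : MulChar (ZMod p) ℂ, χ ≠ 1 → ‖∑ x, χ x * w x‖ ≤ 2 * √p := by
    intro χ hχ
    simp only [hwdef, mul_add, mul_one, Finset.sum_add_distrib, MulChar.sum_eq_zero_of_ne_one hχ,
      zero_add]
    exact norm_sum_mulChar_mul_quadraticChar_le hp2.ne' ha hD hχ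
  have hmain := (norm_sum_mulChar_mul_prod_nontrivialIndicator_le w hw X s hsp hX).2
  have hT : ‖∑ x, (1 : MulChar (ZMod p) ℂ) x *
      ((∏ q ∈ s, nontrivialIndicator (X q) q x) * w x)‖ ≤ 2 := by
    have hterm : ∀ x : ZMod p, ‖(1 : MulChar (ZMod p) ℂ) x *
        ((∏ q ∈ s, nontrivialIndicator (X q) q x) * w x)‖ ≤
        if a * x ^ 2 + b * x + c = 0 then 1 else 0 := by
      intro x
      by_cases hx : x = 0
      · rw [hx, MulChar.map_zero, zero_mul, norm_zero]
        split_ifs <;> norm_num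
      by_cases hq : ∃ q ∈ s, X q x = 1
      · obtain ⟨q, hq, h1⟩ := hq
        have h0 : nontrivialIndicator (X q) q x = 0 :=
          nontrivialIndicator_of_eq_one (hsp q hq).ne_zero h1
        rw [Finset.prod_eq_zero hq h0]
        simp only [zero_mul, mul_zero, norm_zero]
        split_ifs <;> norm_num
      push Not at hq
      have hprim := exists_pow_eq_of_pow_div_ne_one hx fun q hqp hqd h1 => by
        have hqs : q ∈ s := Nat.mem_primeFactors.2 ⟨hqp, hqd, by omega⟩
        obtain ⟨y, rfl⟩ := exists_pow_eq_of_pow_div_eq_one hx hqp.pos hqd h1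
        have hy : y ≠ 0 := by rintro rfl; exact hx (zero_pow hqp.ne_zero)
        refine hq q hqs ?_
        rw [map_pow, ← MulChar.pow_apply' _ hqp.ne_zero]
        nth_rewrite 2 [← hX q hqs]
        rw [pow_orderOf_eq_one, MulChar.one_apply hy.isUnit]
      have hsq := hno x hprim
      rw [Finset.prod_eq_one fun q hqs => nontrivialIndicator_of_ne_one
        (by nth_rewrite 2 [← hX q hqs]; exact pow_orderOf_eq_one _) hx (hq q hqs),
        MulChar.one_apply (Ne.isUnit hx), one_mul, one_mul, hwdef]
      simp only
      split_ifs with hf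
      · rw [hf]; simp
      · rcases quadraticChar_dichotomy hf with h | h
        · obtain ⟨y, hy⟩ := (quadraticChar_one_iff_isSquare hf).1 h
          refine absurd (by rw [hy, sq]) (hsq y ?_)
          rintro rfl
          exact hf (by simpa using hy)
        · simp [h]
    refine (norm_sum_le _ _).trans ((Finset.sum_le_sum fun x _ => hterm x).trans ?_)
    rw [Finset.sum_boole]
    exact_mod_cast card_filter_quadratic_eq_zero_le ha b c
  have hW : (p : ℝ) - 3 ≤ ‖∑ x, (1 : MulChar (ZMod p) ℂ) x * w x‖ := by
    have e : ∑ x, (1 : MulChar (ZMod p) ℂ) x * w x = ((p - 1 : ℝ) : ℂ) -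
        ((quadraticChar (ZMod p) a : ℂ) + (quadraticChar (ZMod p) c : ℂ)) := by
      have h1 : ∀ x, (1 : MulChar (ZMod p) ℂ) x * w x = w x - if x = 0 then w 0 else 0 := by
        intro x
        split_ifs with hx
        · rw [hx, MulChar.map_zero, zero_mul, sub_self]
        · rw [MulChar.one_apply (Ne.isUnit hx)]; simp
      rw [Finset.sum_congr rfl fun x _ => h1 x, Finset.sum_sub_distrib, Finset.sum_ite_eq']
      simp only [hwdef, Finset.mem_univ, if_true, Finset.sum_add_distrib]
      rw [← Int.cast_sum, sum_quadraticChar_quadratic hr2 ha hD]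
      simp
      ring
    rw [e]
    have h1 := norm_sub_norm_le (((p - 1 : ℝ) : ℂ))
      ((quadraticChar (ZMod p) a : ℂ) + (quadraticChar (ZMod p) c : ℂ))
    have h2 : ‖(quadraticChar (ZMod p) a : ℂ) + (quadraticChar (ZMod p) c : ℂ)‖ ≤ 1 + 1 := by
      refine (norm_add_le _ _).trans (add_le_add (norm_quadraticChar_eq_one ha).le ?_)
      by_cases hc : c = 0
      · simp [hc]
      · exact (norm_quadraticChar_eq_one hc).le
    have h3 : (1 : ℝ) ≤ p := by exact_mod_cast hp2.le.trans' (by norm_num)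
    rw [Complex.norm_real, Real.norm_of_nonneg (by linarith)] at h1
    linarith
  set θ : ℝ := ∏ q ∈ s, (1 - (q : ℝ)⁻¹) with hθ
  have hθX : 1 ≤ θ * 2 ^ s.card := one_le_prod_one_sub_inv_mul_two_pow s hsp
  have hθ0 : 0 < θ := by
    by_contra! h
    have : (0 : ℝ) ≤ 2 ^ s.card := by positivity
    nlinarith
  have hθC : ‖∏ q ∈ s, (1 - (q : ℂ)⁻¹)‖ = θ := by
    rw [show (∏ q ∈ s, (1 - (q : ℂ)⁻¹)) = ((θ : ℝ) : ℂ) by rw [hθ]; push_cast; rfl,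
      Complex.norm_real, Real.norm_of_nonneg hθ0.le]
  have hkey : θ * (p - 3) ≤ 2 + θ * (2 ^ s.card - 1) * (2 * √p) := by
    have h1 := norm_sub_norm_le ((∏ q ∈ s, (1 - (q : ℂ)⁻¹)) * ∑ x, (1 : MulChar (ZMod p) ℂ) x * w x)
      (∑ x, (1 : MulChar (ZMod p) ℂ) x * ((∏ q ∈ s, nontrivialIndicator (X q) q x) * w x))
    rw [norm_sub_rev _ (∑ x, _ * _), norm_mul, hθC] at h1
    have h2 := mul_le_mul_of_nonneg_left hW hθ0.le
    linarith
  have hcard : 1 ≤ s.card := by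
    rw [Nat.one_le_iff_ne_zero, Finset.card_ne_zero, hs, Nat.nonempty_primeFactors]
    omega
  have hX2 : (2 : ℝ) ≤ 2 ^ s.card := by
    calc (2 : ℝ) = 2 ^ 1 := (pow_one _).symm
      _ ≤ 2 ^ s.card := pow_le_pow_right₀ one_le_two hcard
  set Y : ℝ := 2 ^ s.card with hY
  have hr : 2 * Y ≤ √p := by
    refine Real.le_sqrt_of_sq_le ?_
    calc (2 * Y) ^ 2 = 4 ^ (s.card + 1) := by
          rw [hY, mul_pow, ← pow_mul, mul_comm s.card 2, pow_mul, pow_succ]; norm_num; ring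
      _ ≤ p := by exact_mod_cast hω
  have hrp : √p * √p = p := Real.mul_self_sqrt (Nat.cast_nonneg p)
  have hfin : θ * (p - 3) ≤ θ * (2 * Y + (Y - 1) * (2 * √p)) := by nlinarith
  have := le_of_mul_le_mul_left hfin hθ0
  nlinarith

/-- The primes below `64`. -/
def smallPrimes : List ℕ := [2, 3, 5, 7, 11, 13, 17, 19, 23, 29, 31, 37, 41, 43, 47, 53, 59, 61]

/-- Whether all prime factors of `n` are below `64`, for `0 < n < 4096`. -/
def isSmooth (n : ℕ) : Bool := smallPrimes.prod ^ 12 % n == 0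

lemma prime_of_mem_smallPrimes {q : ℕ} (h : q ∈ smallPrimes) : q.Prime := by
  simp only [smallPrimes, List.mem_cons, List.not_mem_nil, or_false] at h
  rcases h with rfl | rfl | rfl | rfl | rfl | rfl | rfl | rfl | rfl | rfl | rfl | rfl | rfl | rfl |
    rfl | rfl | rfl | rfl <;> norm_num

lemma mem_smallPrimes_of_dvd_prod {q : ℕ} (hq : q.Prime) (h : q ∣ smallPrimes.prod) :
    q ∈ smallPrimes := by
  obtain ⟨r, hr, hqr⟩ := (Prime.dvd_prod_iff hq.prime).1 h
  rwa [(Nat.prime_dvd_prime_iff_eq hq (prime_of_mem_smallPrimes hr)).1 hqr]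

lemma mem_smallPrimes_of_isSmooth {q n : ℕ} (hq : q.Prime) (hn : isSmooth n = true) (h : q ∣ n) :
    q ∈ smallPrimes :=
  mem_smallPrimes_of_dvd_prod hq
    (hq.dvd_of_dvd_pow (h.trans (Nat.dvd_of_mod_eq_zero (by simpa [isSmooth] using hn))))

/-- Whether `g` is a primitive root modulo a prime `p` with `p - 1` smooth. -/
def isPrimitiveRootMod (p g : ℕ) : Bool :=
  g % p != 0 && smallPrimes.all fun q => (p - 1) % q != 0 || g ^ ((p - 1) / q) % p != 1

lemma natCast_ne_zero_of_isPrimitiveRootMod {p g : ℕ} (hg : isPrimitiveRootMod p g = true) :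
    (g : ZMod p) ≠ 0 := by
  intro h0
  rw [ZMod.natCast_eq_zero_iff] at h0
  simp [isPrimitiveRootMod, Nat.mod_eq_zero_of_dvd h0] at hg

lemma exists_pow_eq_of_isPrimitiveRootMod {p : ℕ} [Fact p.Prime] (hp2 : 2 < p)
    (hs : isSmooth (p - 1) = true) {g : ℕ} (hg : isPrimitiveRootMod p g = true)
    (y : ZMod p) (hy : y ≠ 0) : ∃ n : ℕ, (g : ZMod p) ^ n = y := by
  have hg₀ := natCast_ne_zero_of_isPrimitiveRootMod hg
  rw [isPrimitiveRootMod, Bool.and_eq_true] at hg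
  have key : ∀ q, q.Prime → q ∣ p - 1 → (g : ZMod p) ^ ((p - 1) / q) ≠ 1 := by
    intro q hq hqp h
    have h1 := List.all_eq_true.1 hg.2 q (mem_smallPrimes_of_isSmooth hq hs hqp)
    rw [Nat.mod_eq_zero_of_dvd hqp] at h1
    have h2 : g ^ ((p - 1) / q) % p ≠ 1 := by simpa using h1
    apply h2
    have h3 : ((g ^ ((p - 1) / q) : ℕ) : ZMod p) = (1 : ℕ) := by push_cast; exact h
    rw [ZMod.natCast_eq_natCast_iff'] at h3
    rw [h3, Nat.mod_eq_of_lt (by omega)]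
  exact exists_pow_eq_of_pow_div_ne_one hg₀ key y hy

/-- Applies `k` to a list of at most `n` primitive roots modulo `p` not exceeding `g`, appended in
front of `l`. -/
def withPrimitiveRoots (p : ℕ) (k : List ℕ → Bool) : ℕ → ℕ → List ℕ → Bool
  | 0, _, l => k l
  | _, 0, l => k l
  | .succ g, .succ n, l =>
    cond (isPrimitiveRootMod p g.succ) (withPrimitiveRoots p k g n (g.succ :: l))
      (withPrimitiveRoots p k g n.succ l)

lemma exists_of_withPrimitiveRoots {p : ℕ} {k : List ℕ → Bool} (g n : ℕ) (l : List ℕ)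
    (hl : ∀ x ∈ l, isPrimitiveRootMod p x = true) (h : withPrimitiveRoots p k g n l = true) :
    ∃ l' : List ℕ, (∀ x ∈ l', isPrimitiveRootMod p x = true) ∧ k l' = true := by
  induction g generalizing n l with
  | zero => exact ⟨l, hl, by simpa [withPrimitiveRoots] using h⟩
  | succ g ih =>
    cases n with
    | zero => exact ⟨l, hl, by simpa [withPrimitiveRoots] using h⟩
    | succ n =>
      rw [withPrimitiveRoots] at h
      by_cases hg : isPrimitiveRootMod p (g + 1) = true
      · rw [hg, cond_true] at h
        exact ih _ _ (by simpa [hg] using hl) h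
      · rw [Bool.not_eq_true] at hg
        rw [hg, cond_false] at h
        exact ih _ _ hl h

/-- Applies `k` to `n`; the case distinction makes the kernel evaluate `n` first. -/
def forceNat (k : ℕ → Bool) : ℕ → Bool
  | 0 => k 0
  | .succ n => k n.succ

lemma forceNat_eq (k : ℕ → Bool) (n : ℕ) : forceNat k n = k n := by cases n <;> rfl

/-- The bit mask of the numbers below `2 * p` congruent to `k * x ^ 2` for some `0 < x ≤ n`. -/
def squaresMask (p k : ℕ) : ℕ → ℕ
  | 0 => 0
  | .succ n => 2 ^ (k * n.succ ^ 2 % p) ||| 2 ^ (p + k * n.succ ^ 2 % p) ||| squaresMask p k n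

lemma exists_of_testBit_squaresMask {p k n i : ℕ} (h : (squaresMask p k n).testBit i = true) :
    ∃ x, 0 < x ∧ x ≤ n ∧ (k * x ^ 2 % p = i ∨ p + k * x ^ 2 % p = i) := by
  induction n with
  | zero => simp [squaresMask] at h
  | succ n ih =>
    simp only [squaresMask, Nat.testBit_or, Nat.testBit_two_pow, Bool.or_eq_true,
      decide_eq_true_eq] at h
    rcases h with h | h
    · exact ⟨n + 1, n.succ_pos, le_rfl, h⟩
    · obtain ⟨x, h0, h1, h2⟩ := ih h
      exact ⟨x, h0, h1.trans n.le_succ, h2⟩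

/-- The union of the masks `M >>> (g * (g + b) % p)`, for `g` in `l`. The operations are spelled
out for faster evaluation by the kernel. -/
def shiftUnion (p M b : ℕ) (l : List ℕ) : ℕ :=
  l.foldr (fun g r => Nat.lor (Nat.shiftRight M (Nat.mod (Nat.mul g (Nat.add g b)) p)) r) 0

lemma shiftUnion_cons (p M b g : ℕ) (l : List ℕ) :
    shiftUnion p M b (g :: l) = M >>> (g * (g + b) % p) ||| shiftUnion p M b l := rfl

lemma exists_of_testBit_shiftUnion {p M b i : ℕ} {l : List ℕ}
    (h : (shiftUnion p M b l).testBit i = true) :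
    ∃ g ∈ l, M.testBit (g * (g + b) % p + i) = true := by
  induction l with
  | nil => simp [shiftUnion] at h
  | cons g l ih =>
    rw [shiftUnion_cons, Nat.testBit_or, Nat.testBit_shiftRight, Bool.or_eq_true] at h
    rcases h with h | h
    · exact ⟨g, List.mem_cons_self, h⟩
    · obtain ⟨g', hg', h'⟩ := ih h
      exact ⟨g', List.mem_cons_of_mem _ hg', h'⟩

/-- The numbers below `p` together with their translates by `2 * p`, as a bit mask. -/
def fullMask (p : ℕ) : ℕ := (2 ^ p - 1) ||| (2 ^ p - 1) <<< (2 * p)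

/-- Whether for all `b` and all `c ≠ b ^ 2 / 4` modulo `p`, each of the two masks of length `2 * p`
making up `M` contains `g ^ 2 + b * g + c` for some `g` in `l`. -/
def coversAll (p M full : ℕ) (l : List ℕ) : Bool :=
  (List.range p).all fun b => Nat.beq (full &&& (shiftUnion p M b l |||
    (2 ^ ((b * ((p + 1) / 2)) ^ 2 % p) ||| 2 ^ (2 * p + (b * ((p + 1) / 2)) ^ 2 % p)))) full

lemma exists_of_coversAll {p M : ℕ} {l : List ℕ} (h : coversAll p M (fullMask p) l = true)
    {b c : ℕ} (hb : b < p) (hc : c < p) (hbc : (b * ((p + 1) / 2)) ^ 2 % p ≠ c) :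
    (∃ g ∈ l, M.testBit (g * (g + b) % p + c) = true) ∧
      ∃ g ∈ l, M.testBit (g * (g + b) % p + (2 * p + c)) = true := by
  have h1 := Nat.eq_of_beq_eq_true (List.all_eq_true.1 h b (List.mem_range.2 hb))
  have hlt := Nat.mod_lt ((b * ((p + 1) / 2)) ^ 2) (hb.trans_le' (Nat.zero_le b))
  have key : ∀ i, (i = c ∨ i = 2 * p + c) → ∃ g ∈ l, M.testBit (g * (g + b) % p + i) = true := by
    intro i hi
    apply exists_of_testBit_shiftUnion
    have hfull : (fullMask p).testBit i = true := by
      rw [fullMask, Nat.testBit_or, Nat.testBit_shiftLeft, Nat.testBit_two_pow_sub_one,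
        Nat.testBit_two_pow_sub_one]
      rcases hi with rfl | rfl <;> simp [hc]
    have h2 := hfull
    rw [← h1] at h2
    simp only [Nat.testBit_and, Nat.testBit_or, Nat.testBit_two_pow, Bool.or_eq_true,
      Bool.and_eq_true, decide_eq_true_eq] at h2
    rcases h2.2 with h2 | h2
    · exact h2
    · omega
  exact ⟨key _ (Or.inl rfl), key _ (Or.inr rfl)⟩

/-- Verification of the theorem for a prime `p` such that `p - 1` is smooth. -/
def checkPrime (p : ℕ) : Bool :=
  isSmooth (p - 1) && withPrimitiveRoots p (fun l => match l with
    | [] => false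
    | g :: l => forceNat (fun M => forceNat (fun full => coversAll p M full (g :: l)) (fullMask p))
        (squaresMask p 1 (p - 1) ||| squaresMask p g (p - 1) <<< (2 * p))) (p - 1) 30 []

lemma exists_of_checkPrime {p : ℕ} [Fact p.Prime] (hp2 : 2 < p) (h : checkPrime p = true)
    {a b c : ZMod p} (ha : a ≠ 0) (hD : b ^ 2 - 4 * a * c ≠ 0) :
    ∃ g : ZMod p, (∀ y : ZMod p, y ≠ 0 → ∃ n : ℕ, g ^ n = y) ∧
      ∃ y : ZMod p, y ≠ 0 ∧ y ^ 2 = a * g ^ 2 + b * g + c := by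
  rw [checkPrime, Bool.and_eq_true] at h
  obtain ⟨hs, h⟩ := h
  obtain ⟨l, hl, h⟩ := exists_of_withPrimitiveRoots _ _ _ (by simp) h
  rcases l with - | ⟨g₀, l⟩
  · simp at h
  simp only [forceNat_eq] at h
  have hprim := fun g hg => exists_pow_eq_of_isPrimitiveRootMod hp2 hs (hl g hg)
  have hval : ∀ x : ZMod p, ((x.val : ℕ) : ZMod p) = x := ZMod.natCast_zmod_val
  have hdisc : ((b / a).val * ((p + 1) / 2)) ^ 2 % p ≠ (c / a).val := by
    intro h
    have hhalf : ((((p + 1) / 2 : ℕ) : ZMod p)) * 2 = 1 := by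
      have h2 : (p + 1) / 2 * 2 = p + 1 := by
        have := (Fact.out : p.Prime).eq_two_or_odd
        omega
      calc _ = (((p + 1) / 2 * 2 : ℕ) : ZMod p) := by push_cast; rfl
        _ = 1 := by rw [h2]; simp
    have h3 := congrArg (Nat.cast : ℕ → ZMod p) h
    rw [ZMod.natCast_mod, hval] at h3
    push_cast at h3
    rw [hval] at h3
    apply hD
    have hc : c = a * (b / a * (((p + 1) / 2 : ℕ) : ZMod p)) ^ 2 := by
      rw [h3]; field_simp
    have hb : b = a * (b / a) := by field_simp
    generalize (((p + 1) / 2 : ℕ) : ZMod p) = t at *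
    rw [hc]
    generalize b / a = d at *
    rw [hb]
    linear_combination (-a ^ 2 * d ^ 2 * (t * 2 + 1)) * hhalf
  obtain ⟨h₁, h₂⟩ := exists_of_coversAll h (ZMod.val_lt (b / a)) (ZMod.val_lt (c / a)) hdisc
  have hcast : ∀ {g k x : ℕ}, (k * x ^ 2 % p = g * (g + (b / a).val) % p + (c / a).val ∨
      p + k * x ^ 2 % p = g * (g + (b / a).val) % p + (c / a).val) →
      a * (g : ZMod p) ^ 2 + b * g + c = a * (k * x ^ 2) := by
    intro g k x hx
    have hx' : ((k * x ^ 2 % p : ℕ) : ZMod p) =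
        ((g * (g + (b / a).val) % p + (c / a).val : ℕ) : ZMod p) := by
      rcases hx with hx | hx
      · rw [hx]
      · rw [← hx]; simp
    simp only [Nat.cast_add, ZMod.natCast_mod, Nat.cast_mul, Nat.cast_pow, hval] at hx'
    rw [hx']
    field_simp
  have hx0 : ∀ {x : ℕ}, 0 < x → x ≤ p - 1 → (x : ZMod p) ≠ 0 := by
    intro x h0 h1 h
    rw [ZMod.natCast_eq_zero_iff] at h
    have := Nat.le_of_dvd h0 h
    omega
  have hlt : ∀ n, n % p < p := fun n => Nat.mod_lt _ (by omega)
  have hcp := ZMod.val_lt (c / a)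
  obtain ⟨n, hn⟩ := hprim g₀ List.mem_cons_self a ha
  have hg₀ : (g₀ : ZMod p) ≠ 0 := natCast_ne_zero_of_isPrimitiveRootMod (hl g₀ List.mem_cons_self)
  rcases Nat.even_or_odd' n with ⟨m, rfl | rfl⟩
  · obtain ⟨g, hg, hbit⟩ := h₁
    refine ⟨g, hprim g hg, ?_⟩
    rw [Nat.testBit_or, Nat.testBit_shiftLeft, Bool.or_eq_true, Bool.and_eq_true,
      decide_eq_true_eq] at hbit
    have := hlt (g * (g + (b / a).val))
    obtain ⟨x, h0, h1, hx⟩ := exists_of_testBit_squaresMask (hbit.resolve_right (by omega))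
    refine ⟨g₀ ^ m * x, mul_ne_zero (pow_ne_zero _ hg₀) (hx0 h0 h1), ?_⟩
    rw [hcast hx, ← hn]
    push_cast
    ring
  · obtain ⟨g, hg, hbit⟩ := h₂
    refine ⟨g, hprim g hg, ?_⟩
    rw [Nat.testBit_or, Nat.testBit_shiftLeft, Bool.or_eq_true, Bool.and_eq_true,
      decide_eq_true_eq] at hbit
    have := hlt (g * (g + (b / a).val))
    have hbit' := hbit.resolve_left fun hbit => by
      obtain ⟨x, h0, h1, hx⟩ := exists_of_testBit_squaresMask hbit
      have := hlt (1 * x ^ 2)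
      omega
    rw [show g * (g + (b / a).val) % p + (2 * p + (c / a).val) - 2 * p =
      g * (g + (b / a).val) % p + (c / a).val by omega] at hbit'
    obtain ⟨x, h0, h1, hx⟩ := exists_of_testBit_squaresMask hbit'.2
    refine ⟨g₀ ^ (m + 1) * x, mul_ne_zero (pow_ne_zero _ hg₀) (hx0 h0 h1), ?_⟩
    rw [hcast hx, ← hn]
    ring

/-- Reduction of the theorem for `n < 4096` to `checkPrime`, using an upper bound for the number of
prime factors of `n - 1`. -/
def checkSmall (n : ℕ) : Bool :=
  n.gcd smallPrimes.prod != 1 && !smallPrimes.elem n || n == 19 || n == 31 ||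
    Nat.ble (4 ^ ((smallPrimes.filter fun q => (n - 1) % q == 0).length +
      cond (isSmooth (n - 1)) 1 2)) n ||
    checkPrime n

lemma all_checkSmall_lt_2048 : ((List.range' 14 2034).all checkSmall) = true := by
  decide +kernel

lemma all_checkSmall_lt_3072 : ((List.range' 2048 1024).all checkSmall) = true := by
  decide +kernel

lemma all_checkSmall_lt_4096 : ((List.range' 3072 1024).all checkSmall) = true := by
  decide +kernel

lemma checkSmall_of_lt {n : ℕ} (h13 : 13 < n) (hn : n < 4096) : checkSmall n = true := by
  rcases lt_or_ge n 2048 with h1 | h1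
  · exact List.all_eq_true.1 all_checkSmall_lt_2048 n (by rw [List.mem_range'_1]; omega)
  rcases lt_or_ge n 3072 with h2 | h2
  · exact List.all_eq_true.1 all_checkSmall_lt_3072 n (by rw [List.mem_range'_1]; omega)
  · exact List.all_eq_true.1 all_checkSmall_lt_4096 n (by rw [List.mem_range'_1]; omega)

lemma le_of_prime_of_notMem_smallPrimes {q : ℕ} (hq : q.Prime) (h : q ∉ smallPrimes) : 64 ≤ q := by
  by_contra! hlt
  have : ∀ q < 64, q.Prime → q ∈ smallPrimes := by decide
  exact h (this q hlt hq)

lemma card_primeFactors_le {m : ℕ} (hm0 : m ≠ 0) (hm : m < 4096) :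
    m.primeFactors.card + 1 ≤ (smallPrimes.filter fun q => m % q == 0).length +
      cond (isSmooth m) 1 2 := by
  have h1 : (m.primeFactors.filter (· ∈ smallPrimes)).card ≤
      (smallPrimes.filter fun q => m % q == 0).length := by
    refine le_trans (Finset.card_le_card fun q hq => ?_) (List.toFinset_card_le _)
    rw [Finset.mem_filter] at hq
    rw [List.mem_toFinset, List.mem_filter]
    exact ⟨hq.2, by simpa using Nat.mod_eq_zero_of_dvd (Nat.dvd_of_mem_primeFactors hq.1)⟩
  have h2 : (m.primeFactors.filter (· ∉ smallPrimes)).card + 1 ≤ cond (isSmooth m) 1 2 := by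
    by_cases hs : isSmooth m = true
    · rw [hs, cond_true, Nat.succ_le_succ_iff, Nat.le_zero, Finset.card_eq_zero,
        Finset.filter_eq_empty_iff]
      intro q hq
      rw [not_not]
      exact mem_smallPrimes_of_isSmooth (Nat.prime_of_mem_primeFactors hq) hs
        (Nat.dvd_of_mem_primeFactors hq)
    · rw [Bool.not_eq_true] at hs
      rw [hs, cond_false]
      refine Nat.succ_le_succ (Finset.card_le_one.2 fun q hq r hr => ?_)
      by_contra hne
      rw [Finset.mem_filter, Nat.mem_primeFactors] at hq hr
      have hdvd := ((Nat.coprime_primes hq.1.1 hr.1.1).2 hne).mul_dvd_of_dvd_of_dvd hq.1.2.1 hr.1.2.1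
      have := Nat.le_of_dvd (Nat.pos_of_ne_zero hm0) hdvd
      have := le_of_prime_of_notMem_smallPrimes hq.1.1 hq.2
      have := le_of_prime_of_notMem_smallPrimes hr.1.1 hr.2
      nlinarith
  rw [← Finset.card_filter_add_card_filter_not (s := m.primeFactors) (· ∈ smallPrimes)]
  omega

/-- A product of `k` distinct primes is at least the product of the first `k` primes. -/
lemma prod_nth_prime_le_prod (s : Finset ℕ) (hs : ∀ q ∈ s, q.Prime) :
    ∏ i ∈ Finset.range s.card, Nat.nth Nat.Prime i ≤ ∏ q ∈ s, q := by
  induction s using Finset.induction_on_max with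
  | empty => simp
  | insert q s hq ih =>
    have hqs : q ∉ s := fun h => (hq q h).false
    rw [Finset.card_insert_of_notMem hqs, Finset.prod_range_succ, Finset.prod_insert hqs, mul_comm]
    refine Nat.mul_le_mul ?_ (ih fun r hr => hs r (Finset.mem_insert_of_mem hr))
    refine Nat.lt_succ_iff.1 (Nat.nth_lt_of_lt_count ?_)
    have hp := hs q (Finset.mem_insert_self q s)
    rw [Nat.count_succ, if_pos hp, Nat.lt_succ_iff, Nat.count_eq_card_filter_range]
    refine Finset.card_le_card fun r hr => ?_
    rw [Finset.mem_filter, Finset.mem_range]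
    exact ⟨hq r hr, hs r (Finset.mem_insert_of_mem hr)⟩

lemma four_pow_le_prod_nth_prime (k : ℕ) :
    4 ^ (k + 7) ≤ ∏ i ∈ Finset.range (k + 6), Nat.nth Nat.Prime i := by
  have h4 : ∀ k, 11 < Nat.nth Nat.Prime (k + 5) := fun k => by
    rw [← Nat.nth_prime_four_eq_eleven]
    exact Nat.nth_strictMono Nat.infinite_setOfPred_prime (by omega)
  induction k with
  | zero =>
    simp only [Finset.prod_range_succ, Finset.prod_range_zero, Nat.nth_prime_zero_eq_two,
      Nat.nth_prime_one_eq_three, Nat.nth_prime_two_eq_five, Nat.nth_prime_three_eq_seven,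
      Nat.nth_prime_four_eq_eleven]
    have := h4 0
    norm_num at this ⊢
    omega
  | succ k ih =>
    rw [show k + 1 + 6 = k + 6 + 1 by ring, Finset.prod_range_succ,
      show k + 1 + 7 = k + 7 + 1 by ring, pow_succ]
    exact Nat.mul_le_mul ih (by have := h4 (k + 1); rw [show k + 6 = k + 1 + 5 by ring]; omega)

lemma four_pow_card_primeFactors_le {m : ℕ} (hm : 4095 ≤ m) :
    4 ^ (m.primeFactors.card + 1) ≤ m + 1 := by
  rcases lt_or_ge m.primeFactors.card 6 with h | h
  · calc 4 ^ (m.primeFactors.card + 1) ≤ 4 ^ 6 := Nat.pow_le_pow_right (by norm_num) h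
      _ ≤ m + 1 := by omega
  · obtain ⟨k, hk⟩ := Nat.exists_eq_add_of_le' h
    have h1 := prod_nth_prime_le_prod m.primeFactors fun q hq => Nat.prime_of_mem_primeFactors hq
    have h2 := Nat.le_of_dvd (by omega) (Nat.prod_primeFactors_dvd m)
    have h3 := four_pow_le_prod_nth_prime k
    rw [hk] at h1 ⊢
    exact (h3.trans (h1.trans h2)).trans m.le_succ

theorem sun_conjecture {p : ℕ} (hp : p.Prime) (hp13 : 13 < p) (hp19 : p ≠ 19) (hp31 : p ≠ 31)
    (a b c : ZMod p) (ha : a ≠ 0) (hdisc : b ^ 2 - 4 * a * c ≠ 0) :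
    ∃ g : ZMod p, (∀ y : ZMod p, y ≠ 0 → ∃ n : ℕ, g ^ n = y) ∧
      ∃ y : ZMod p, y ≠ 0 ∧ y ^ 2 = a * g ^ 2 + b * g + c := by
  have : Fact p.Prime := ⟨hp⟩
  have hp2 : 2 < p := by omega
  by_cases hω : 4 ^ ((p - 1).primeFactors.card + 1) ≤ p
  · exact exists_of_four_pow_le hp2 hω ha hdisc
  have hlt : p < 4096 := by
    by_contra! hge
    have := four_pow_card_primeFactors_le (m := p - 1) (by omega)
    rw [Nat.sub_add_cancel hp.one_le] at this
    exact hω this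
  refine exists_of_checkPrime hp2 ?_ ha hdisc
  have hcheck := checkSmall_of_lt hp13 hlt
  simp only [checkSmall, Bool.or_eq_true, Bool.and_eq_true, beq_iff_eq, bne_iff_ne,
    Bool.not_eq_true', Nat.ble_eq] at hcheck
  rcases hcheck with (((h | h) | h) | h) | h
  · refine absurd (mem_smallPrimes_of_dvd_prod hp ?_) (by simpa using h.2)
    by_contra hnd
    exact h.1 ((Nat.Prime.coprime_iff_not_dvd hp).2 hnd)
  · exact absurd h hp19
  · exact absurd h hp31
  · exact absurd ((Nat.pow_le_pow_right (by norm_num)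
      (card_primeFactors_le (by omega) (by omega))).trans h) hω
  · exact h
end

section
/- Let q be a prime power, F_q the finite field with q elements, k a positive divisor of q-1 with k ≥ 2, and f(x) = ax² + bx + c ∈ F_q[x] a quadratic polynomial (a ≠ 0) with b² - 4ac ≠ 0. Let t be a divisor of q-1 with Rad(t) < Rad(q-1), and let p₁, …, p_s be the distinct primes dividing q-1 but not dividing t. Then N(q-1, k) ≥ Σ_{i=1}^{s} N(p_i t, k) - (s-1) N(t, k). -/
open scoped Classical

/-- `g` is a primitive element of the finite field `F`, i.e. a generator of `Fˣ`. -/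
def IsPrimitiveElement {F : Type*} [Field F] [Fintype F] (g : F) : Prop :=
  ∀ y : F, y ≠ 0 → ∃ n : ℕ, g ^ n = y

/-- `x` is `t`-free: `x ≠ 0` and `x = y ^ d` with `d ∣ t`, `d > 0` forces `d = 1`. -/
def IsTFree {F : Type*} [Field F] (t : ℕ) (x : F) : Prop :=
  x ≠ 0 ∧ ∀ d : ℕ, 0 < d → d ∣ t → (∃ y : F, y ^ d = x) → d = 1

/-- `N(t, k)`: the number of `t`-free `x ∈ F` with `f(x) = a x² + b x + c` a nonzero
`k`-th power. -/
noncomputable def Ncount (F : Type*) [Field F] [Fintype F] (a b c : F) (t k : ℕ) : ℕ :=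
  Nat.card {x : F | IsTFree t x ∧ ∃ y : F, y ≠ 0 ∧ y ^ k = a * x ^ 2 + b * x + c}

/-- `W(n)`: the number of squarefree positive divisors of `n`. -/
noncomputable def Wnum (n : ℕ) : ℕ := (n.divisors.filter Squarefree).card

/-- `Rad(n)`: the product of the distinct primes dividing `n`. -/
noncomputable def rad (n : ℕ) : ℕ := ∏ p ∈ n.primeFactors, p

theorem isTFree_iff_prime {F : Type*} [Field F] {t : ℕ} {x : F} :
    IsTFree t x ↔ x ≠ 0 ∧ ∀ p : ℕ, p.Prime → p ∣ t → ¬ ∃ y : F, y ^ p = x := by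
  refine and_congr_right fun _ => ⟨fun h p hp hpt hy => hp.ne_one (h p hp.pos hpt hy), ?_⟩
  rintro h d - hdt ⟨y, rfl⟩
  by_contra hd
  obtain ⟨p, hp, m, rfl⟩ := Nat.exists_prime_and_dvd hd
  exact h p hp (dvd_of_mul_right_dvd hdt) ⟨y ^ m, by rw [← pow_mul, mul_comm]⟩

theorem IsTFree.of_dvd {F : Type*} [Field F] {t u : ℕ} {x : F} (h : IsTFree u x) (htu : t ∣ u) :
    IsTFree t x :=
  ⟨h.1, fun d hd hdt => h.2 d hd (hdt.trans htu)⟩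

/-- Freeness for `n` follows from freeness for `t` and for all `p * t` with `p` a prime dividing
`n` but not `t`. -/
theorem isTFree_of_forall_mul {F : Type*} [Field F] {n t : ℕ} (hn : n ≠ 0) (ht : t ≠ 0) {x : F}
    (hx : IsTFree t x) (h : ∀ p ∈ n.primeFactors \ t.primeFactors, IsTFree (p * t) x) :
    IsTFree n x := by
  refine isTFree_iff_prime.2 ⟨hx.1, fun p hp hpn => ?_⟩
  by_cases hpt : p ∣ t
  · exact (isTFree_iff_prime.1 hx).2 p hp hpt
  · have hpP : p ∈ n.primeFactors \ t.primeFactors := by simp [hp, hpn, hpt, hn, ht]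
    exact (isTFree_iff_prime.1 (h p hpP)).2 p hp (dvd_mul_right p t)

/-- The union bound for the complements in `A` of the sets cut out by `R p`, `p ∈ P`. -/
theorem sum_card_filter_sub_le {α ι : Type*} (A : Finset α) (P : Finset ι) (R : ι → α → Prop) :
    (∑ p ∈ P, ((A.filter (R p)).card : ℤ)) - ((P.card : ℤ) - 1) * (A.card : ℤ)
      ≤ ((A.filter fun x => ∀ p ∈ P, R p x).card : ℤ) := by
  induction P using Finset.induction_on with
  | empty => simp
  | insert p P hp ih =>
    have h := Finset.card_union_add_card_inter (A.filter (R p)) (A.filter fun x => ∀ i ∈ P, R i x)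
    have hle := Finset.card_le_card (Finset.union_subset (Finset.filter_subset (R p) A)
      (Finset.filter_subset (fun x => ∀ i ∈ P, R i x) A))
    rw [← Finset.filter_and] at h
    simp only [Finset.forall_mem_insert, Finset.sum_insert hp, Finset.card_insert_of_notMem hp]
    push_cast
    zify at h hle
    linarith

theorem Ncount_eq_card_filter {F : Type*} [Field F] [Fintype F] (a b c : F) (t k : ℕ) :
    Ncount F a b c t k = (Finset.univ.filter fun x : F =>
      IsTFree t x ∧ ∃ y : F, y ≠ 0 ∧ y ^ k = a * x ^ 2 + b * x + c).card := by
  rw [Ncount, Nat.card_eq_fintype_card]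
  exact Fintype.card_subtype _

theorem Ncount_sieve_lower_bound
    {F : Type*} [Field F] [Fintype F] {q k : ℕ} (hq : Fintype.card F = q)
    (hk : 2 ≤ k) (hkdvd : k ∣ q - 1)
    (a b c : F) (ha : a ≠ 0) (hdisc : b ^ 2 - 4 * a * c ≠ 0)
    {t : ℕ} (ht0 : 0 < t) (htdvd : t ∣ q - 1) (hrad : rad t < rad (q - 1))
    {P : Finset ℕ} (hP : P = (q - 1).primeFactors \ t.primeFactors)
    {s : ℕ} (hs : s = P.card) :
    (∑ p ∈ P, (Ncount F a b c (p * t) k : ℤ)) - ((s : ℤ) - 1) * (Ncount F a b c t k : ℤ)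
      ≤ (Ncount F a b c (q - 1) k : ℤ) := by
  subst hs hP
  have hn : q - 1 ≠ 0 := by
    have := Fintype.one_lt_card (α := F)
    omega
  have key := sum_card_filter_sub_le (Finset.univ.filter fun x : F =>
      IsTFree t x ∧ ∃ y : F, y ≠ 0 ∧ y ^ k = a * x ^ 2 + b * x + c)
    ((q - 1).primeFactors \ t.primeFactors) (fun p x => IsTFree (p * t) x)
  simp only [Finset.filter_filter] at key
  simp only [Ncount_eq_card_filter]
  refine le_trans (sub_le_sub_right (Finset.sum_le_sum fun p _ => ?_) _) (key.trans ?_)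
  · refine Nat.cast_le.2 (Finset.card_le_card (Finset.monotone_filter_right _ ?_))
    exact fun x _ hx => ⟨⟨hx.1.of_dvd (dvd_mul_left t p), hx.2⟩, hx.1⟩
  · refine Nat.cast_le.2 (Finset.card_le_card (Finset.monotone_filter_right _ ?_))
    exact fun x _ hx => ⟨isTFree_of_forall_mul hn ht0.ne' hx.1.1 hx.2, hx.1.2⟩
end

section
/- Let q be a prime power, F_q the finite field with q elements, k a positive divisor of q-1 with k ≥ 2, and f(x) = ax² + bx + c ∈ F_q[x] a quadratic polynomial (a ≠ 0) with b² - 4ac ≠ 0. Let t be a divisor of q-1 with Rad(t) < Rad(q-1), let p₁, …, p_s be the distinct primes dividing q-1 but not dividing t, and set δ = 1 - Σ_{i=1}^{s} 1/p_i. Then N(q-1, k) ≥ Σ_{i=1}^{s} ( N(p_i t, k) - (1 - 1/p_i) N(t, k) ) + δ · N(t, k). -/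
open scoped Classical

/-- `t`-freeness passes to divisors of `t`. -/
lemma IsTFree.of_dvd_s5 {F : Type*} [Field F] {m n : ℕ} {x : F} (hmn : m ∣ n)
    (hx : IsTFree n x) : IsTFree m x :=
  ⟨hx.1, fun d hd hdm hy => hx.2 d hd (hdm.trans hmn) hy⟩

/-- A nonzero element that is not `n`-free is a `p`-th power for some prime `p ∣ n`. -/
lemma exists_prime_pow_eq_of_not_isTFree {F : Type*} [Field F] {n : ℕ} {x : F} (hx : x ≠ 0)
    (h : ¬ IsTFree n x) : ∃ p : ℕ, p.Prime ∧ p ∣ n ∧ ∃ y : F, y ^ p = x := by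
  have h' : ∃ d : ℕ, 0 < d ∧ d ∣ n ∧ (∃ y : F, y ^ d = x) ∧ d ≠ 1 := by
    by_contra! hd
    exact h ⟨hx, hd⟩
  obtain ⟨d, -, hdn, ⟨y, hy⟩, hd1⟩ := h'
  refine ⟨d.minFac, Nat.minFac_prime hd1, (Nat.minFac_dvd d).trans hdn, y ^ (d / d.minFac), ?_⟩
  rw [← pow_mul, Nat.div_mul_cancel (Nat.minFac_dvd d), hy]

/-- A union bound: if every element of `A` outside `C` lies outside some `B i`, then `C` has at
least `#A - ∑ i, (#A - #(B i))` elements. -/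
lemma card_le_card_add_sum_sub {α ι : Type*} {A C : Finset α} {P : Finset ι} {B : ι → Finset α}
    (hB : ∀ i ∈ P, B i ⊆ A) (hC : ∀ x ∈ A, x ∉ C → ∃ i ∈ P, x ∉ B i) :
    (A.card : ℝ) ≤ C.card + ∑ i ∈ P, ((A.card : ℝ) - (B i).card) := by
  have hsub : A ⊆ C ∪ P.biUnion fun i => A \ B i := by
    intro x hx
    by_cases hxC : x ∈ C
    · exact Finset.mem_union_left _ hxC
    · obtain ⟨i, hi, hxi⟩ := hC x hx hxC
      exact Finset.mem_union_right _
        (Finset.mem_biUnion.2 ⟨i, hi, Finset.mem_sdiff.2 ⟨hx, hxi⟩⟩)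
  have hcard : A.card ≤ C.card + ∑ i ∈ P, (A \ B i).card :=
    (Finset.card_le_card hsub).trans <| (Finset.card_union_le _ _).trans <|
      Nat.add_le_add_left Finset.card_biUnion_le _
  calc (A.card : ℝ) ≤ C.card + ∑ i ∈ P, ((A \ B i).card : ℝ) := by exact_mod_cast hcard
    _ = C.card + ∑ i ∈ P, ((A.card : ℝ) - (B i).card) := by
      congr 1
      refine Finset.sum_congr rfl fun i hi => ?_
      rw [Finset.card_sdiff_of_subset (hB i hi), Nat.cast_sub (Finset.card_le_card (hB i hi))]

theorem Ncount_sieve_lower_bound_delta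
    {F : Type*} [Field F] [Fintype F] {q k : ℕ} (hq : Fintype.card F = q)
    (hk : 2 ≤ k) (hkdvd : k ∣ q - 1)
    (a b c : F) (ha : a ≠ 0) (hdisc : b ^ 2 - 4 * a * c ≠ 0)
    {t : ℕ} (ht0 : 0 < t) (htdvd : t ∣ q - 1) (hrad : rad t < rad (q - 1))
    {P : Finset ℕ} (hP : P = (q - 1).primeFactors \ t.primeFactors)
    {s : ℕ} (hs : s = P.card)
    {δ : ℝ} (hδ : δ = 1 - ∑ p ∈ P, (1 : ℝ) / p) :
    (∑ p ∈ P, ((Ncount F a b c (p * t) k : ℝ)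
        - (1 - 1 / (p : ℝ)) * (Ncount F a b c t k : ℝ)))
      + δ * (Ncount F a b c t k : ℝ) ≤ (Ncount F a b c (q - 1) k : ℝ) := by
  have hq1 : q - 1 ≠ 0 := by
    have := Fintype.one_lt_card (α := F)
    omega
  let S : ℕ → Finset F := fun n =>
    Finset.univ.filter fun x => IsTFree n x ∧ ∃ y : F, y ≠ 0 ∧ y ^ k = a * x ^ 2 + b * x + c
  have hS : ∀ n, Ncount F a b c n k = (S n).card := fun n => by
    simp only [Ncount, S, Nat.card_eq_fintype_card, Set.coe_ofPred, Fintype.card_subtype]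
  have key := card_le_card_add_sum_sub (A := S t) (C := S (q - 1)) (P := P)
    (B := fun p => S (p * t)) ?_ ?_
  · simp only [hS, hδ]
    simp only [sub_mul, one_mul, Finset.sum_sub_distrib, Finset.sum_mul] at key ⊢
    linarith
  · intro p _ x hx
    simp only [S, Finset.mem_filter, Finset.mem_univ, true_and] at hx ⊢
    exact ⟨hx.1.of_dvd_s5 (Dvd.intro_left p rfl), hx.2⟩
  · intro x hx hxC
    simp only [S, Finset.mem_filter, Finset.mem_univ, true_and] at hx hxC ⊢
    obtain ⟨p, hp, hpq, hy⟩ :=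
      exists_prime_pow_eq_of_not_isTFree hx.1.1 fun hfree => hxC ⟨hfree, hx.2⟩
    refine ⟨p, ?_, fun hpt => hp.ne_one (hpt.1.2 p hp.pos (Dvd.intro t rfl) hy)⟩
    rw [hP, Finset.mem_sdiff]
    exact ⟨Nat.mem_primeFactors.2 ⟨hp, hpq, hq1⟩, fun hpt =>
      hp.ne_one (hx.1.2 p hp.pos (Nat.dvd_of_mem_primeFactors hpt) hy)⟩
end
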